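/- Let m ≥ 2 be an integer, q = 2^m, and let R' be a real number with 1/2 ≤ R' ≤ 1 − 1/(2^m − 1). There exists a sequence of F_{q^2}-linear codes D_i ⊆ F_{q^2}^{N_i} containing their Euclidean duals, D_i^{⊥} ⊆ D_i, such that lim_{i→∞} N_i = ∞, liminf_{i→∞} (dim_{F_{q^2}} D_i)/N_i ≥ R', and liminf_{i→∞} d_H(D_i)/N_i ≥ 1 − R' − 1/(2^m − 1), where d_H(D_i) denotes the minimum Hamming weight of a nonzero codeword of D_i. -/

import Mathlib

open Filter

/-- The Euclidean dual `D^⊥ = {x : ∑ x_i y_i = 0 for all y ∈ D}`. -/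
def eucDual {F : Type*} [Field F] {ι : Type*} [Fintype ι]
    (D : Set (ι → F)) : Set (ι → F) :=
  {x | ∀ y ∈ D, ∑ i, x i * y i = 0}

/-- The Hamming weight: the number of nonzero coordinates. -/
noncomputable def hWeight {F : Type*} [Field F] {ι : Type*} (x : ι → F) : ℕ :=
  Set.ncard {i : ι | x i ≠ 0}

/-- The minimum Hamming weight of a nonzero codeword of `D`. -/
noncomputable def minHammingDist {F : Type*} [Field F] {ι : Type*}
    (D : Set (ι → F)) : ℕ :=
  sInf (hWeight '' {x ∈ D | x ≠ 0})



namespace GSC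

set_option linter.unusedSectionVars false
set_option linter.unusedSimpArgs false

/-- Standing numerical assumption `q = 2^m`. -/
class QP (q : ℕ) : Prop where
  pow : ∃ m, 2 ≤ m ∧ q = 2 ^ m

/-- Standing numerical assumption `|K| = q^2`. -/
class GS (q : ℕ) (K : Type) [Field K] [Fintype K] : Prop where
  card : Fintype.card K = q ^ 2

/-- The additive polynomial `x^q + x`. -/
def T {R : Type} [CommRing R] (q : ℕ) (x : R) : R := x ^ q + x

/-- The elements of the field with `q` elements inside `K`. -/
noncomputable def Fq (q : ℕ) (K : Type) [Field K] [Fintype K] : Finset K :=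
  open Classical in Finset.univ.filter (fun β : K => β ^ q = β)

section basic
variable {q : ℕ} [hQ : QP q] {K L : Type} [Field K] [Fintype K] [CharP K 2] [hGS : GS q K]

theorem mem_Fq {β : K} : β ∈ Fq q K ↔ β ^ q = β := by
  classical
  simp [Fq]

variable (q) in
theorem q_ge : 4 ≤ q := by
  obtain ⟨m, hm, rfl⟩ := hQ.pow
  calc 4 = 2 ^ 2 := by norm_num
    _ ≤ 2 ^ m := Nat.pow_le_pow_right (by norm_num) hm

variable (q) in
theorem q_pos : 0 < q := by
  have := q_ge q; omega

theorem add_pow_q {R : Type} [CommRing R] [CharP R 2] (x y : R) :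
    (x + y) ^ q = x ^ q + y ^ q := by
  obtain ⟨m, hm, rfl⟩ := hQ.pow
  have : Fact (Nat.Prime 2) := ⟨Nat.prime_two⟩
  exact add_pow_char_pow x y 2 m

theorem T_add {R : Type} [CommRing R] [CharP R 2] (x y : R) :
    T q (x + y) = T q x + T q y := by
  unfold T; rw [add_pow_q]; ring

theorem ch2 {R : Type} [CommRing R] [CharP R 2] (x : R) : x + x = 0 := CharTwo.add_self_eq_zero x

theorem ch2_sub {R : Type} [CommRing R] [CharP R 2] (x y : R) : x - y = x + y :=
  CharTwo.sub_eq_add x y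

theorem T_zero {R : Type} [CommRing R] : T q (0:R) = 0 := by
  unfold T; rw [zero_pow (q_pos q).ne']; simp

theorem T_sub {R : Type} [CommRing R] [CharP R 2] (x y : R) :
    T q (x - y) = T q x - T q y := by
  rw [ch2_sub, T_add, ch2_sub]

theorem zero_mem_Fq : (0:K) ∈ Fq q K := by
  rw [mem_Fq, zero_pow (q_pos q).ne']

theorem one_mem_Fq : (1:K) ∈ Fq q K := by
  rw [mem_Fq, one_pow]

theorem add_mem_Fq {a b : K} (ha : a ∈ Fq q K) (hb : b ∈ Fq q K) : a + b ∈ Fq q K := by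
  rw [mem_Fq] at *; rw [add_pow_q, ha, hb]

theorem T_eq_zero_iff {a : K} : T q a = 0 ↔ a ∈ Fq q K := by
  rw [mem_Fq, T, ← ch2_sub, sub_eq_zero]

theorem pow_qq (a : K) : a ^ (q ^ 2) = a := by
  rw [← hGS.card]; exact FiniteField.pow_card a

theorem T_mem_Fq (a : K) : T q a ∈ Fq q K := by
  rw [mem_Fq, T, add_pow_q, ← pow_mul, ← pow_two, pow_qq]; ring

open Polynomial in
theorem natDegree_Tpoly {R : Type} [Field R] (c : R) (hq : 1 < q) :
    (X ^ q + X + C c : R[X]).natDegree = q ∧ (X ^ q + X + C c : R[X]).Monic := by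
  have h1 : (X + C c : R[X]).degree < (q : ℕ) := by
    rw [degree_X_add_C]; exact_mod_cast hq
  rw [add_assoc]
  exact ⟨natDegree_eq_of_degree_eq_some (by rw [degree_add_eq_left_of_degree_lt] <;> simp [degree_X_pow]; exact hq),
    monic_X_pow_add h1⟩

open Polynomial in
theorem card_Fq : (Fq q K).card = q := by
  classical
  apply le_antisymm
  · obtain ⟨hd, hm⟩ := natDegree_Tpoly (0 : K) (q := q) (by have := q_ge q; omega)
    refine (Finset.card_le_card (t := (X ^ q + X + C 0 : K[X]).roots.toFinset) ?_).trans
      ((Multiset.toFinset_card_le _).trans ((card_roots' _).trans hd.le))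
    intro β hβ
    rw [Multiset.mem_toFinset, mem_roots hm.ne_zero]
    simpa [T] using T_eq_zero_iff.2 hβ
  · have h : (Finset.univ : Finset K).card ≤ q * (Fq q K).card := by
      refine Finset.card_le_mul_card_image_of_maps_to (f := T q) (t := Fq q K) (fun a _ => T_mem_Fq a) q ?_
      intro b hb
      obtain ⟨hd, hm⟩ := natDegree_Tpoly (b : K) (q := q) (by have := q_ge q; omega)
      refine (Finset.card_le_card (t := (X ^ q + X + C b : K[X]).roots.toFinset) ?_).trans
        ((Multiset.toFinset_card_le _).trans ((card_roots' _).trans hd.le))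
      intro β hβ
      rw [Finset.mem_filter] at hβ
      rw [Multiset.mem_toFinset, mem_roots hm.ne_zero]
      have := hβ.2
      unfold T at this
      simp [this, ch2]
    rw [Finset.card_univ, hGS.card, pow_two] at h
    exact Nat.le_of_mul_le_mul_left h (q_pos q)

theorem exists_T_eq {b : K} (hb : b ∈ Fq q K) : ∃ a : K, T q a = b := by
  classical
  by_contra hne
  push Not at hne
  have hz : b ∉ Finset.univ.image (T q : K → K) := by simpa using hne
  have h : (Finset.univ : Finset K).card ≤ q * (Finset.univ.image (T q : K → K)).card := by
    refine Finset.card_le_mul_card_image (f := T q) _ q ?_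
    intro b hb
    obtain ⟨a, -, rfl⟩ := Finset.mem_image.1 hb
    have : (Finset.univ.filter (fun x => T q x = T q a)) ⊆ (Fq q K).image (fun β => a + β) := by
      intro x hx
      simp only [Finset.mem_filter, Finset.mem_univ, true_and] at hx
      refine Finset.mem_image.2 ⟨x - a, ?_, by ring⟩
      rw [← T_eq_zero_iff, T_sub, hx, sub_self]
    exact (Finset.card_le_card this).trans (Finset.card_image_le.trans card_Fq.le)
  rw [Finset.card_univ, hGS.card, pow_two] at h
  have h2 := Nat.le_of_mul_le_mul_left h (q_pos q)
  have h3 : (insert b (Finset.univ.image (T q : K → K))).card ≤ (Fq q K).card := by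
    apply Finset.card_le_card
    intro x hx
    rcases Finset.mem_insert.1 hx with rfl | hx
    · exact hb
    · obtain ⟨a, -, rfl⟩ := Finset.mem_image.1 hx
      exact T_mem_Fq a
  rw [Finset.card_insert_of_notMem hz, card_Fq] at h3
  omega

variable [Field L] [CharP L 2] [Algebra K L]

theorem algebraMap_T (a : K) : algebraMap K L (T q a) = T q (algebraMap K L a) := by
  simp [T]

theorem T_mul_Fq {β : K} (hβ : β ∈ Fq q K) (y : L) :
    T q (algebraMap K L β * y) = algebraMap K L β * T q y := by
  rw [mem_Fq] at hβ
  simp only [T, mul_pow, ← map_pow, hβ]; ring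

theorem T_algebraMap_Fq {β : K} (hβ : β ∈ Fq q K) : T q (algebraMap K L β) = 0 := by
  rw [← algebraMap_T, T_eq_zero_iff.2 hβ, map_zero]

theorem T_add_Fq {β : K} (hβ : β ∈ Fq q K) (y : L) : T q (y + algebraMap K L β) = T q y := by
  rw [T_add, T_algebraMap_Fq hβ, add_zero]

open Polynomial in
/-- `X^q + X = ∏ (X + β)`. -/
theorem T_eq_prod (y : L) : T q y = ∏ β ∈ Fq q K, (y + algebraMap K L β) := by
  classical
  obtain ⟨hd, hm⟩ := natDegree_Tpoly (0 : L) (q := q) (by have := q_ge q; omega)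
  have h : (X ^ q + X + C 0 : L[X]) - ∏ β ∈ Fq q K, (X - C (algebraMap K L β)) = 0 := by
    apply Polynomial.eq_zero_of_degree_lt_of_eval_index_eq_zero (s := Fq q K) (v := algebraMap K L)
    · exact (algebraMap K L).injective.injOn
    · have hc : ((Fq q K).card : WithBot ℕ) = (X ^ q + X + C 0 : L[X]).degree := by
        rw [degree_eq_natDegree hm.ne_zero, hd, card_Fq]
      rw [hc]
      apply degree_sub_lt_left
      · rw [← hc, degree_prod]; simp
      · exact hm.ne_zero
      · rw [hm.leadingCoeff, (monic_prod_of_monic _ _ (fun i _ => monic_X_sub_C _)).leadingCoeff]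
    · intro β hβ
      have := T_algebraMap_Fq (L := L) hβ
      unfold T at this
      rw [eval_sub, eval_prod, Finset.prod_eq_zero hβ] <;> simp [this]
  have h2 := congrArg (Polynomial.eval y) (sub_eq_zero.1 h)
  simp only [eval_add, eval_pow, eval_X, eval_C, add_zero, eval_prod, eval_sub] at h2
  rw [T, h2]
  exact Finset.prod_congr rfl fun β _ => ch2_sub _ _

theorem eq_add_of_T_eq {y z : L} (h : T q y = T q z) : ∃ β ∈ Fq q K, y = z + algebraMap K L β := by
  have h0 : T q (y - z) = 0 := by rw [T_sub, h, sub_self]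
  rw [T_eq_prod (K := K)] at h0
  obtain ⟨β, hβ, h1⟩ := Finset.prod_eq_zero_iff.1 h0
  refine ⟨β, hβ, ?_⟩
  rw [← ch2_sub, sub_eq_zero] at h1
  rw [← h1]; ring

open Polynomial in
theorem exists_T_eq_L [IsAlgClosed L] (z : L) : ∃ y : L, T q y = z := by
  obtain ⟨hd, hm⟩ := natDegree_Tpoly (-z : L) (q := q) (by have := q_ge q; omega)
  obtain ⟨y, hy⟩ := IsAlgClosed.exists_root (X ^ q + X + C (-z) : L[X])
    (by rw [degree_eq_natDegree hm.ne_zero, hd]; have := q_ge q; simp; omega)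
  refine ⟨y, ?_⟩
  simp only [IsRoot, eval_add, eval_pow, eval_X, eval_C] at hy
  rw [T]; linear_combination hy

end basic

end GSC



namespace GSC
set_option linter.unusedSectionVars false
set_option linter.unusedSimpArgs false

section seq
variable {q : ℕ} [hQ : QP q] {K L : Type} [Field K] [Fintype K] [CharP K 2] [hGS : GS q K]
  [Field L] [CharP L 2] [Algebra K L]

theorem ne_zero_of_T {x : L} (h : T q x ≠ 0) : x ≠ 0 := by
  rintro rfl; exact h T_zero

variable (q L) in
/-- Geometric points of the tower. -/
abbrev S : Type := {x : ℕ → L // T q (x 0) ≠ 0 ∧ ∀ i, T q (x (i+1)) * T q (x i) = x i ^ (q+1)}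

theorem S.T_ne (x : S q L) (i : ℕ) : T q (x.1 i) ≠ 0 := by
  induction i with
  | zero => exact x.2.1
  | succ i ih =>
    intro h
    have := x.2.2 i
    rw [h, zero_mul] at this
    exact ne_zero_of_T ih (pow_eq_zero_iff (by omega) |>.1 this.symm)

theorem S.ne (x : S q L) (i : ℕ) : x.1 i ≠ 0 := ne_zero_of_T (x.T_ne i)

theorem S.T_succ (x : S q L) (i : ℕ) : T q (x.1 (i+1)) = x.1 i ^ (q+1) * (T q (x.1 i))⁻¹ := by
  rw [← x.2.2 i, mul_assoc, mul_inv_cancel₀ (x.T_ne i), mul_one]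

theorem T_inv {x : L} (hx : x ≠ 0) : T q x⁻¹ = T q x * (x ^ (q+1))⁻¹ := by
  unfold T; rw [inv_pow]; field_simp; ring

theorem S.T_inv (x : S q L) (i : ℕ) : T q (x.1 i)⁻¹ = (T q (x.1 (i+1)))⁻¹ := by
  rw [GSC.T_inv (x.ne i), x.T_succ, mul_inv, inv_inv, mul_comm]

theorem next_exists [IsAlgClosed L] (a : {a : L // T q a ≠ 0}) :
    ∃ b : {a : L // T q a ≠ 0}, T q b.1 * T q a.1 = a.1 ^ (q+1) := by
  obtain ⟨y, hy⟩ := exists_T_eq_L (q := q) (a.1 ^ (q+1) * (T q a.1)⁻¹)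
  refine ⟨⟨y, ?_⟩, ?_⟩
  · rw [hy]
    exact mul_ne_zero (pow_ne_zero _ (ne_zero_of_T a.2)) (inv_ne_zero a.2)
  · rw [hy, mul_assoc, inv_mul_cancel₀ a.2, mul_one]

theorem S.exists_start [IsAlgClosed L] (a : L) (ha : T q a ≠ 0) : ∃ x : S q L, x.1 0 = a := by
  choose nx hnx using next_exists (q := q) (L := L)
  refine ⟨⟨fun i => (nx^[i] ⟨a, ha⟩).1, ?_, ?_⟩, rfl⟩
  · exact ha
  · intro i
    simp only [Function.iterate_succ_apply']
    exact hnx _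

theorem S.exists_extend [IsAlgClosed L] (x : S q L) (n : ℕ) (w : L)
    (hw : T q w * T q (x.1 n) = x.1 n ^ (q+1)) :
    ∃ y : S q L, (∀ i ≤ n, y.1 i = x.1 i) ∧ y.1 (n+1) = w := by
  have hw0 : T q w ≠ 0 := by
    intro h
    rw [h, zero_mul] at hw
    exact x.ne n (pow_eq_zero_iff (by omega) |>.1 hw.symm)
  obtain ⟨z, hz⟩ := S.exists_start w hw0
  refine ⟨⟨fun i => if i ≤ n then x.1 i else z.1 (i - (n+1)), ?_, ?_⟩, ?_, ?_⟩
  · simpa using x.2.1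
  · intro i
    dsimp only
    rcases lt_trichotomy i n with h | h | h
    · rw [if_pos (by omega), if_pos (by omega)]; exact x.2.2 i
    · subst h
      simp only [le_refl, if_true]
      rw [if_neg (by omega), Nat.sub_self, hz, hw]
    · rw [if_neg (by omega), if_neg (by omega), show i + 1 - (n+1) = (i - (n+1)) + 1 by omega]
      exact z.2.2 _
  · intro i hi
    simp [hi]
  · simp [hz]

theorem S.exists_mv [IsAlgClosed L] (x : S q L) (n : ℕ) (β : K) (hβ : β ∈ Fq q K) :
    ∃ y : S q L, (∀ i ≤ n, y.1 i = x.1 i) ∧ y.1 (n+1) = x.1 (n+1) + algebraMap K L β := by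
  apply S.exists_extend
  rw [T_add_Fq hβ, x.2.2]

open Classical in
/-- Move the coordinate `n+1` by `β`. -/
noncomputable def mv [IsAlgClosed L] (n : ℕ) (x : S q L) (β : K) : S q L :=
  if h : β ∈ Fq q K then (S.exists_mv x n β h).choose else x

theorem mv_le [IsAlgClosed L] (n : ℕ) (x : S q L) (β : K) {i : ℕ} (hi : i ≤ n) :
    (mv n x β).1 i = x.1 i := by
  unfold mv
  split_ifs with h
  · exact (S.exists_mv x n β h).choose_spec.1 i hi
  · rfl

theorem mv_succ [IsAlgClosed L] (n : ℕ) (x : S q L) {β : K} (hβ : β ∈ Fq q K) :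
    (mv n x β).1 (n+1) = x.1 (n+1) + algebraMap K L β := by
  unfold mv
  rw [dif_pos hβ]
  exact (S.exists_mv x n β hβ).choose_spec.2

variable (q L) in
/-- Coordinate functions. -/
def X (i : ℕ) : S q L → L := fun x => x.1 i

variable (q L) in
/-- The function `1/T(X_0)`. -/
def invT0 : S q L → L := fun x => (T q (x.1 0))⁻¹

variable (q L) in
/-- The function `T(X_0)`. -/
def T0 : S q L → L := fun x => T q (x.1 0)

variable (q K L) in
/-- The ring of functions on level `n`. -/
def A (n : ℕ) : Subalgebra K (S q L → L) :=
  Algebra.adjoin K (insert (invT0 q L) {f | ∃ i ≤ n, f = X q L i})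

theorem X_mem {i n : ℕ} (h : i ≤ n) : X q L i ∈ A q K L n :=
  Algebra.subset_adjoin (Set.mem_insert_of_mem _ ⟨i, h, rfl⟩)

theorem invT0_mem (n : ℕ) : invT0 q L ∈ A q K L n :=
  Algebra.subset_adjoin (Set.mem_insert _ _)

theorem A_mono {m n : ℕ} (h : m ≤ n) : A q K L m ≤ A q K L n := by
  apply Algebra.adjoin_mono
  apply Set.insert_subset_insert
  rintro f ⟨i, hi, rfl⟩
  exact ⟨i, hi.trans h, rfl⟩

theorem A_congr {n : ℕ} {f : S q L → L} (hf : f ∈ A q K L n) {x y : S q L}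
    (h : ∀ i ≤ n, x.1 i = y.1 i) : f x = f y := by
  induction hf using Algebra.adjoin_induction with
  | mem f hf =>
    rcases hf with rfl | ⟨i, hi, rfl⟩
    · simp [invT0, h 0 (Nat.zero_le _)]
    · exact h i hi
  | algebraMap r => rfl
  | add f g _ _ hf hg => simp [hf, hg]
  | mul f g _ _ hf hg => simp [hf, hg]


theorem TX_mem {i n : ℕ} (h : i ≤ n) : (fun x : S q L => T q (x.1 i)) ∈ A q K L n :=
  add_mem (pow_mem (X_mem h) q) (X_mem h)

theorem T0_mem (n : ℕ) : T0 q L ∈ A q K L n := TX_mem (Nat.zero_le n)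

theorem inv_mem_aux (i : ℕ) : (fun x : S q L => (T q (x.1 i))⁻¹) ∈ A q K L i ∧
    (fun x : S q L => (x.1 i)⁻¹) ∈ A q K L i := by
  have key : ∀ i, (fun x : S q L => (T q (x.1 i))⁻¹) ∈ A q K L i →
      (fun x : S q L => (x.1 i)⁻¹) ∈ A q K L i := by
    intro i h
    have h2 := mul_mem h (add_mem (pow_mem (X_mem (q := q) (L := L) (le_refl i)) (q-1)) (one_mem (A q K L i)))
    convert h2 using 1
    funext x
    have h1 := x.ne i
    have h3 := x.T_ne i
    simp only [Pi.mul_apply, Pi.add_apply, Pi.pow_apply, Pi.one_apply, X]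
    have h4 : T q (x.1 i) = (x.1 i) * (x.1 i ^ (q-1) + 1) := by
      rw [T, mul_add, ← pow_succ', Nat.sub_add_cancel (q_pos q), mul_one]
    rw [h4] at h3 ⊢
    have h5 := right_ne_zero_of_mul h3
    field_simp
  induction i with
  | zero => exact ⟨invT0_mem 0, key 0 (invT0_mem 0)⟩
  | succ i ih =>
    have : (fun x : S q L => (T q (x.1 (i+1)))⁻¹) ∈ A q K L (i+1) := by
      apply A_mono (Nat.le_succ i)
      have h2 := add_mem (pow_mem ih.2 q) ih.2
      convert h2 using 1
      funext x
      rw [← x.T_inv]; rfl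
    exact ⟨this, key _ this⟩

theorem invTX_mem {i n : ℕ} (h : i ≤ n) : (fun x : S q L => (T q (x.1 i))⁻¹) ∈ A q K L n :=
  A_mono h (inv_mem_aux i).1

theorem invX_mem {i n : ℕ} (h : i ≤ n) : (fun x : S q L => (x.1 i)⁻¹) ∈ A q K L n :=
  A_mono h (inv_mem_aux i).2

/-- `T(X_{n+1})` lies on level `n`. -/
theorem TX_succ_mem (n : ℕ) : (fun x : S q L => T q (x.1 (n+1))) ∈ A q K L n := by
  have := mul_mem (pow_mem (X_mem (q := q) (L := L) (K := K) (le_refl n)) (q+1)) (invTX_mem (le_refl n))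
  convert this using 1
  funext x
  exact x.T_succ n

/-- The expansion in powers of `u = X_{n+1} + c`. -/
theorem expand {n : ℕ} {c : S q L → L} (hc : c ∈ A q K L n) {f : S q L → L}
    (hf : f ∈ A q K L (n+1)) :
    ∃ a : ℕ → S q L → L, (∀ k, a k ∈ A q K L n) ∧
      f = ∑ k ∈ Finset.range q, a k * (X q L (n+1) + c) ^ k := by
  set u := X q L (n+1) + c with hu
  obtain ⟨z, hz, huz⟩ : ∃ z ∈ A q K L n, u ^ q = u + z := by
    refine ⟨_, add_mem (TX_succ_mem n) (add_mem (pow_mem hc q) hc), ?_⟩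
    funext x
    simp only [Pi.mul_apply, Pi.add_apply, Pi.pow_apply, X, hu]
    rw [add_pow_q, T]
    have h1 := ch2 (x.1 (n+1))
    have h2 := ch2 (c x)
    linear_combination -h1 - h2
  let E : (S q L → L) → Prop := fun f => ∃ a : ℕ → S q L → L, (∀ k, a k ∈ A q K L n) ∧
      f = ∑ k ∈ Finset.range q, a k * u ^ k
  have hq := q_ge q
  have Eadd : ∀ f g, E f → E g → E (f + g) := by
    rintro f g ⟨a, ha, rfl⟩ ⟨b, hb, rfl⟩
    refine ⟨fun k => a k + b k, fun k => add_mem (ha k) (hb k), ?_⟩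
    rw [← Finset.sum_add_distrib]
    exact Finset.sum_congr rfl fun k _ => by ring
  have Esmul : ∀ c ∈ A q K L n, ∀ f, E f → E (c * f) := by
    rintro c hc f ⟨a, ha, rfl⟩
    refine ⟨fun k => c * a k, fun k => mul_mem hc (ha k), ?_⟩
    rw [Finset.mul_sum]
    exact Finset.sum_congr rfl fun k _ => by ring
  have Elow : ∀ k < q, E (u ^ k) := by
    intro k hk
    refine ⟨fun j => if j = k then 1 else 0, fun j => ?_, ?_⟩
    · dsimp only
      split_ifs
      · exact one_mem _
      · exact zero_mem _
    · simp [hk]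
  have E0 : E 0 := ⟨fun _ => 0, fun _ => zero_mem _, by simp⟩
  have Esum : ∀ (s : Finset ℕ) (g : ℕ → S q L → L), (∀ i ∈ s, E (g i)) → E (∑ i ∈ s, g i) := by
    intro s g hg
    exact Finset.sum_induction g E Eadd E0 hg
  have EA : ∀ c ∈ A q K L n, E c := by
    intro c hc
    have := Esmul c hc _ (Elow 0 (by omega))
    simpa using this
  have Eu : ∀ f, E f → E (u * f) := by
    rintro f ⟨a, ha, rfl⟩
    rw [Finset.mul_sum]
    apply Esum
    intro k hk
    rw [Finset.mem_range] at hk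
    have : u * (a k * u ^ k) = a k * u ^ (k+1) := by ring
    rw [this]
    apply Esmul _ (ha k)
    by_cases hk' : k + 1 < q
    · exact Elow _ hk'
    · rw [show k + 1 = q by omega, huz]
      apply Eadd
      · simpa using Elow 1 (by omega)
      · exact EA z hz
  have Eupow : ∀ k f, E f → E (u ^ k * f) := by
    intro k
    induction k with
    | zero => intro f hf; simpa using hf
    | succ k ih => intro f hf; rw [pow_succ, mul_assoc]; exact ih _ (Eu f hf)
  have Emul : ∀ f g, E f → E g → E (f * g) := by
    rintro f g ⟨a, ha, rfl⟩ hg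
    rw [Finset.sum_mul]
    apply Esum
    intro k hk
    rw [mul_assoc]
    exact Esmul _ (ha k) _ (Eupow k g hg)
  change E f
  induction hf using Algebra.adjoin_induction with
  | mem f hf =>
    rcases hf with rfl | ⟨i, hi, rfl⟩
    · exact EA _ (invT0_mem n)
    · rcases Nat.lt_or_ge n i with h | h
      · rw [show i = n + 1 by omega]
        have : X q L (n+1) = u + (-1) * c := by rw [hu]; ring
        rw [this]
        exact Eadd _ _ (by simpa using Elow 1 (by omega)) (EA _ (mul_mem (neg_mem (one_mem _)) hc))
      · exact EA _ (X_mem h)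
  | algebraMap r => exact EA _ (Subalgebra.algebraMap_mem _ r)
  | add f g _ _ hf hg => exact Eadd _ _ hf hg
  | mul f g _ _ hf hg => exact Emul _ _ hf hg

end seq
end GSC



namespace GSC
set_option linter.unusedSectionVars false
set_option linter.unusedSimpArgs false

section norms
variable {q : ℕ} [hQ : QP q] {K L : Type} [Field K] [Fintype K] [CharP K 2] [hGS : GS q K]
  [NormedField L] [IsUltrametricDist L] [IsAlgClosed L] [CharP L 2] [Algebra K L]

theorem mul_inv_le_one_iff_real {a b : ℝ} (hb : 0 < b) : a * b⁻¹ ≤ 1 ↔ a ≤ b := by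
  rw [← div_eq_mul_inv, div_le_one hb]

theorem norm_add_le_max' (x y : L) : ‖x + y‖ ≤ max ‖x‖ ‖y‖ := IsUltrametricDist.norm_add_le_max x y

theorem norm_add_le_of {x y : L} {r : ℝ} (hx : ‖x‖ ≤ r) (hy : ‖y‖ ≤ r) : ‖x + y‖ ≤ r :=
  (norm_add_le_max' x y).trans (max_le hx hy)

theorem norm_add_lt_of {x y : L} {r : ℝ} (hx : ‖x‖ < r) (hy : ‖y‖ < r) : ‖x + y‖ < r :=
  (norm_add_le_max' x y).trans_lt (max_lt hx hy)

theorem norm_add_left {x y : L} (h : ‖y‖ < ‖x‖) : ‖x + y‖ = ‖x‖ := by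
  rw [IsUltrametricDist.norm_add_eq_max_of_norm_ne_norm h.ne', max_eq_left h.le]

theorem norm_add_right {x y : L} (h : ‖x‖ < ‖y‖) : ‖x + y‖ = ‖y‖ := by
  rw [add_comm, norm_add_left h]

theorem norm_fin_order {x : L} {n : ℕ} (hn : n ≠ 0) (h : x ^ n = 1) : ‖x‖ = 1 := by
  have := congrArg norm h
  rw [norm_pow, norm_one] at this
  exact (pow_eq_one_iff_of_nonneg (norm_nonneg _) hn).1 this

theorem norm_K {β : K} (hβ : β ≠ 0) : ‖algebraMap K L β‖ = 1 := by
  have h := FiniteField.pow_card_sub_one_eq_one β hβ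
  have h1 : Fintype.card K - 1 ≠ 0 := by
    have := Fintype.one_lt_card (α := K); omega
  exact norm_fin_order h1 (by rw [← map_pow, h, map_one])

theorem norm_K_le (β : K) : ‖algebraMap K L β‖ ≤ 1 := by
  by_cases h : β = 0
  · simp [h]
  · exact (norm_K h).le

theorem norm_T_small {y : L} (h : ‖y‖ < 1) : ‖T q y‖ = ‖y‖ := by
  by_cases h0 : y = 0
  · rw [h0, T_zero]
  unfold T
  apply norm_add_right
  rw [norm_pow]
  have := q_ge q
  have h1 : 0 < ‖y‖ := norm_pos_iff.2 h0
  calc ‖y‖ ^ q < ‖y‖ ^ 1 := pow_lt_pow_right_of_lt_one₀ h1 h (by omega)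
    _ = _ := pow_one _

theorem norm_T_large {y : L} (h : 1 < ‖y‖) : ‖T q y‖ = ‖y‖ ^ q := by
  unfold T
  rw [← norm_pow]
  apply norm_add_left
  rw [norm_pow]
  have := q_ge q
  calc ‖y‖ = ‖y‖ ^ 1 := (pow_one _).symm
    _ < ‖y‖ ^ q := pow_lt_pow_right₀ h (by omega)

theorem norm_T_le {y : L} (h : ‖y‖ ≤ 1) : ‖T q y‖ ≤ 1 := by
  unfold T
  apply norm_add_le_of _ h
  rw [norm_pow]; exact pow_le_one₀ (norm_nonneg _) h

theorem norm_le_of_T {y : L} (h : ‖T q y‖ ≤ 1) : ‖y‖ ≤ 1 := by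
  by_contra hc
  push Not at hc
  rw [norm_T_large hc] at h
  have := one_lt_pow₀ hc (q_pos q).ne'
  linarith

theorem one_lt_of_T {y : L} (h : 1 < ‖T q y‖) : 1 < ‖y‖ := by
  by_contra hc
  push Not at hc
  exact absurd (norm_T_le (q := q) hc) (not_le.2 h)

variable (K) in
theorem near_of_T {y : L} (h : ‖T q y‖ < 1) : ∃ ω ∈ Fq q K, ‖y + algebraMap K L ω‖ < 1 := by
  by_contra hc
  push Not at hc
  rw [T_eq_prod (K := K), norm_prod] at h
  have : 1 ≤ ∏ β ∈ Fq q K, ‖y + algebraMap K L β‖ := by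
    calc (1:ℝ) = ∏ β ∈ Fq q K, 1 := by simp
      _ ≤ _ := Finset.prod_le_prod (fun _ _ => zero_le_one) hc
  linarith

theorem norm_near {y : L} {ω : K} (hω : ω ∈ Fq q K) (h : ‖y + algebraMap K L ω‖ < 1) :
    ‖y + algebraMap K L ω‖ = ‖T q y‖ := by
  rw [← norm_T_small (q := q) h, T_add_Fq hω]

/-- Sums of terms with pairwise different norms. -/
theorem sum_distinct {ι : Type} [DecidableEq ι] (s : Finset ι) (g : ι → L)
    (h : ∀ i ∈ s, ∀ j ∈ s, i ≠ j → ‖g i‖ = ‖g j‖ → g i = 0) :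
    (∀ i ∈ s, ‖g i‖ ≤ ‖∑ i ∈ s, g i‖) ∧
      (∑ i ∈ s, g i = 0 ∨ ∃ i ∈ s, g i ≠ 0 ∧ ‖∑ i ∈ s, g i‖ = ‖g i‖) := by
  induction s using Finset.induction_on with
  | empty => simp
  | insert a s ha ih =>
    obtain ⟨h1, h2⟩ := ih (fun i hi j hj => h i (Finset.mem_insert_of_mem hi) j (Finset.mem_insert_of_mem hj))
    rw [Finset.sum_insert ha]
    by_cases h0 : ∑ i ∈ s, g i = 0
    · rw [h0, add_zero]
      rw [h0, norm_zero] at h1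
      refine ⟨?_, ?_⟩
      · intro i hi
        rcases Finset.mem_insert.1 hi with rfl | hi
        · exact le_rfl
        · exact (h1 i hi).trans (norm_nonneg _)
      · by_cases hga : g a = 0
        · exact Or.inl hga
        · exact Or.inr ⟨a, Finset.mem_insert_self _ _, hga, rfl⟩
    · obtain ⟨i0, hi0, hgi0, hn⟩ := h2.resolve_left h0
      have hne : ‖g a‖ ≠ ‖∑ i ∈ s, g i‖ := by
        intro he
        rw [hn] at he
        exact hgi0 (h i0 (Finset.mem_insert_of_mem hi0) a (Finset.mem_insert_self _ _)
          (fun e => ha (e ▸ hi0)) he.symm)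
      rw [IsUltrametricDist.norm_add_eq_max_of_norm_ne_norm hne]
      refine ⟨?_, ?_⟩
      · intro i hi
        rcases Finset.mem_insert.1 hi with rfl | hi
        · exact le_max_left _ _
        · exact (h1 i hi).trans (le_max_right _ _)
      · right
        rcases lt_or_gt_of_ne hne with hl | hl
        · exact ⟨i0, Finset.mem_insert_of_mem hi0, hgi0, by rw [max_eq_right hl.le, hn]⟩
        · refine ⟨a, Finset.mem_insert_self _ _, ?_, by rw [max_eq_left hl.le]⟩
          rintro h00
          rw [h00, norm_zero] at hl
          exact absurd hl (not_lt.2 (norm_nonneg _))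

/-- Digits: `∑_{k<q} a_k y^k` with `‖a_k‖ ∈ ρ^{qℤ} ∪ {0}` and `‖y‖ = ρ ^ e`, `e = ±1`. -/
theorem sum_digits {ρ : ℝ} (hρ : 0 < ρ) (hρ1 : ρ ≠ 1) {y : L} (hy : ‖y‖ = ρ)
    (a : ℕ → L) (ha : ∀ k < q, a k = 0 ∨ ∃ j : ℤ, ‖a k‖ = ρ ^ ((q:ℤ) * j)) :
    (∀ k < q, ‖a k * y ^ k‖ ≤ ‖∑ k ∈ Finset.range q, a k * y ^ k‖) ∧
      (∑ k ∈ Finset.range q, a k * y ^ k = 0 ∨ ∃ k < q, ∃ j : ℤ, ‖a k‖ = ρ ^ ((q:ℤ) * j) ∧ a k ≠ 0 ∧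
        ‖∑ k ∈ Finset.range q, a k * y ^ k‖ = ρ ^ ((q:ℤ) * j + k)) := by
  have hnorm : ∀ k, ∀ j : ℤ, ‖a k‖ = ρ ^ ((q:ℤ) * j) → ‖a k * y ^ k‖ = ρ ^ ((q:ℤ) * j + k) := by
    intro k j h
    rw [norm_mul, h, norm_pow, hy, zpow_add₀ hρ.ne', zpow_natCast]
  obtain ⟨h1, h2⟩ := sum_distinct (Finset.range q) (fun k => a k * y ^ k) (by
    intro i hi j hj hij he
    rw [Finset.mem_range] at hi hj
    rcases ha i hi with h0 | ⟨ji, hji⟩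
    · simp [h0]
    rcases ha j hj with h0 | ⟨jj, hjj⟩
    · simp only [h0, zero_mul, norm_zero] at he
      exact norm_eq_zero.1 he
    exfalso
    rw [hnorm i ji hji, hnorm j jj hjj] at he
    have h3 : (q:ℤ) * ji + i = (q:ℤ) * jj + j := zpow_right_injective₀ hρ hρ1 he
    have h4 : ((q:ℤ) * ji + i) % q = ((q:ℤ) * jj + j) % q := by rw [h3]
    rw [Int.mul_add_emod_self_left, Int.mul_add_emod_self_left] at h4
    norm_cast at h4
    rw [Nat.mod_eq_of_lt hi, Nat.mod_eq_of_lt hj] at h4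
    exact hij h4)
  refine ⟨fun k hk => h1 k (Finset.mem_range.2 hk), h2.imp_right ?_⟩
  rintro ⟨k, hk, hne, hn⟩
  rw [Finset.mem_range] at hk
  rcases ha k hk with h0 | ⟨j, hj⟩
  · simp [h0] at hne
  · exact ⟨k, hk, j, hj, left_ne_zero_of_mul hne, by rw [hn, hnorm k j hj]⟩

/-! ### Places over `T(x_0) = 0` -/

theorem S.norm_rel (x : S q L) (i : ℕ) : ‖T q (x.1 (i+1))‖ * ‖T q (x.1 i)‖ = ‖x.1 i‖ ^ (q+1) := by
  rw [← norm_mul, x.2.2, norm_pow]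

theorem S.norm_pos (x : S q L) (i : ℕ) : 0 < ‖x.1 i‖ := norm_pos_iff.2 (x.ne i)
theorem S.norm_T_pos (x : S q L) (i : ℕ) : 0 < ‖T q (x.1 i)‖ := norm_pos_iff.2 (x.T_ne i)

theorem S.step_small (x : S q L) {i : ℕ} (h : ‖x.1 i‖ < 1) :
    ‖T q (x.1 (i+1))‖ = ‖T q (x.1 i)‖ ^ q := by
  have h1 := x.norm_rel i
  rw [norm_T_small h] at h1 ⊢
  rw [pow_succ] at h1
  exact mul_right_cancel₀ (x.norm_pos i).ne' h1

theorem S.step_large (x : S q L) {i : ℕ} (h : 1 < ‖x.1 i‖) :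
    1 < ‖x.1 (i+1)‖ ∧ ‖x.1 (i+1)‖ ^ q = ‖x.1 i‖ := by
  have h1 := x.norm_rel i
  rw [norm_T_large h, pow_succ, mul_comm] at h1
  have h2 := mul_left_cancel₀ (pow_pos (x.norm_pos i) q).ne' h1
  have h3 : 1 < ‖x.1 (i+1)‖ := one_lt_of_T (q := q) (by rw [h2]; exact h)
  exact ⟨h3, by rw [← h2, norm_T_large h3]⟩

theorem S.small_T (x : S q L) {t : ℕ} (h : ∀ i < t, ‖x.1 i‖ < 1) {i : ℕ} (hi : i ≤ t) :
    ‖T q (x.1 i)‖ = ‖T q (x.1 0)‖ ^ (q ^ i) := by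
  induction i with
  | zero => simp
  | succ i ih => rw [x.step_small (h i (by omega)), ih (by omega), ← pow_mul, pow_succ]

theorem S.small_norm (x : S q L) {t : ℕ} (h : ∀ i < t, ‖x.1 i‖ < 1) {i : ℕ} (hi : i < t) :
    ‖x.1 i‖ = ‖T q (x.1 0)‖ ^ (q ^ i) := by
  rw [← x.small_T h hi.le, norm_T_small (h i hi)]

/-- Ramification type of a point near `T(x_0) = 0`. -/
structure S.Ty (x : S q L) (t : ℕ) (ω : K) : Prop where
  lt : ‖T q (x.1 0)‖ < 1
  small : ∀ i < t, ‖x.1 i‖ < 1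
  mem : ω ∈ Fq q K
  ne : ω ≠ 0
  near : ‖x.1 t + algebraMap K L ω‖ < 1

variable (K) in
theorem S.trichotomy (x : S q L) (h : ‖T q (x.1 0)‖ < 1) :
    (∀ i, ‖x.1 i‖ < 1) ∨ ∃ t, ∃ ω : K, x.Ty t ω := by
  classical
  by_cases hs : ∀ i, ‖x.1 i‖ < 1
  · exact Or.inl hs
  right
  have hs' : ∃ i, ¬ ‖x.1 i‖ < 1 := by push Not at hs ⊢; exact hs
  have hlt : ∀ i < Nat.find hs', ‖x.1 i‖ < 1 := fun i hi => not_not.1 (Nat.find_min hs' hi)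
  have hT : ‖T q (x.1 (Nat.find hs'))‖ < 1 := by
    rw [x.small_T hlt le_rfl]
    exact pow_lt_one₀ (norm_nonneg _) h (pow_pos (q_pos q) _).ne'
  obtain ⟨ω, hω, hn⟩ := near_of_T K hT
  refine ⟨Nat.find hs', ω, h, hlt, hω, ?_, hn⟩
  rintro rfl
  rw [map_zero, add_zero] at hn
  exact Nat.find_spec hs' hn

section ty
variable {x : S q L} {t : ℕ} {ω : K}

theorem S.Ty.norm_t (h : x.Ty t ω) : ‖x.1 t‖ = 1 := by
  have h1 : x.1 t = (x.1 t + algebraMap K L ω) + algebraMap K L ω := by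
    rw [add_assoc, ch2, add_zero]
  rw [h1, norm_add_right] <;> rw [norm_K h.ne]
  exact h.near

theorem S.Ty.T_pos (_h : x.Ty t ω) : 0 < ‖T q (x.1 0)‖ := x.norm_T_pos 0

theorem S.Ty.near_eq (h : x.Ty t ω) : ‖x.1 t + algebraMap K L ω‖ = ‖T q (x.1 0)‖ ^ (q^t) := by
  rw [norm_near h.mem h.near, x.small_T h.small le_rfl]

theorem S.Ty.large (h : x.Ty t ω) (j : ℕ) :
    1 < ‖x.1 (t+1+j)‖ ∧ ‖x.1 (t+1+j)‖ ^ (q^(j+1)) * ‖T q (x.1 0)‖ ^ (q^t) = 1 := by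
  induction j with
  | zero =>
    have h1 := x.norm_rel t
    rw [h.norm_t, one_pow, x.small_T h.small le_rfl] at h1
    have h2 : ‖T q (x.1 0)‖ ^ (q^t) < 1 := pow_lt_one₀ (norm_nonneg _) h.lt (pow_pos (q_pos q) _).ne'
    have h4 : 0 < ‖T q (x.1 0)‖ ^ (q^t) := pow_pos h.T_pos _
    have h3 : 1 < ‖T q (x.1 (t+1))‖ := by
      by_contra hc
      push Not at hc
      nlinarith
    have h5 : 1 < ‖x.1 (t+1)‖ := one_lt_of_T h3
    refine ⟨h5, ?_⟩
    rw [norm_T_large h5] at h1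
    simpa using h1
  | succ j ih =>
    obtain ⟨h1, h2⟩ := x.step_large ih.1
    refine ⟨h1, ?_⟩
    rw [← h2, ← pow_mul, ← pow_succ'] at ih
    exact ih.2

theorem S.Ty.large' (h : x.Ty t ω) {n : ℕ} (hn : t < n) :
    1 < ‖x.1 n‖ ∧ ‖x.1 n‖ ^ (q^(n-t)) * ‖T q (x.1 0)‖ ^ (q^t) = 1 := by
  have := h.large (n - t - 1)
  rw [show t + 1 + (n-t-1) = n by omega, show n - t - 1 + 1 = n - t by omega] at this
  exact this

theorem S.Ty.root (h : x.Ty t ω) {n : ℕ} (hn : 2 * t < n) :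
    ‖x.1 n‖ ^ (q^(n-2*t)) * ‖T q (x.1 0)‖ = 1 := by
  have h1 := (h.large' (n := n) (by omega)).2
  rw [show n - t = n - 2*t + t by omega, pow_add q, pow_mul, ← mul_pow] at h1
  exact (pow_eq_one_iff_of_nonneg (by positivity) (pow_pos (q_pos q) t).ne').1 h1

theorem S.Ty.lower (h : x.Ty t ω) (i : ℕ) : ‖T q (x.1 0)‖ ^ (q^i) ≤ ‖x.1 i‖ := by
  rcases lt_trichotomy i t with hi | rfl | hi
  · exact (x.small_norm h.small hi).ge
  · rw [h.norm_t]; exact pow_le_one₀ (norm_nonneg _) h.lt.le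
  · exact (pow_le_one₀ (norm_nonneg _) h.lt.le).trans (h.large' hi).1.le

theorem inv_T_large {y : L} (hy : 1 < ‖(y : L)‖) : ‖y ^ (q+1) * (T q y)⁻¹ + y‖ ≤ 1 := by
  have hT : T q y ≠ 0 := by
    rw [← norm_pos_iff, norm_T_large hy]; positivity
  have : y ^ (q+1) * (T q y)⁻¹ + y = y^2 * (T q y)⁻¹ := by
    field_simp
    have h1 := ch2 (y ^ (q+1))
    rw [T]
    linear_combination h1
  rw [this, norm_mul, norm_inv, norm_T_large hy, norm_pow, mul_inv_le_one_iff_real (by positivity)]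
  exact pow_le_pow_right₀ hy.le (by have := q_ge q; omega)

theorem inv_T_small {y : L} (h0 : y ≠ 0) (hy : ‖y‖ < 1) : ‖(T q y)⁻¹ + y⁻¹‖ ≤ 1 := by
  have h1 := norm_T_small (q := q) hy
  have hp : 0 < ‖y‖ := norm_pos_iff.2 h0
  have hT : T q y ≠ 0 := by
    rw [← norm_pos_iff, h1]; exact hp
  have : (T q y)⁻¹ + y⁻¹ = y^q * (T q y * y)⁻¹ := by
    field_simp
    have h1 := ch2 y
    rw [T]
    linear_combination h1
  rw [this, norm_mul, norm_inv, norm_mul, h1, norm_pow, mul_inv_le_one_iff_real (by positivity), ← pow_two]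
  exact pow_le_pow_of_le_one hp.le hy.le (by have := q_ge q; omega)

theorem S.Ty.mirror (h : x.Ty t ω) {i : ℕ} (hi : i + 1 ≤ t) :
    ‖x.1 (t+(i+1)) + algebraMap K L ω ^ 2 * (x.1 (t-(i+1)))⁻¹‖ ≤ 1 := by
  set w := algebraMap K L ω with hw
  have hwq : w ^ q = w := by rw [hw, ← map_pow, mem_Fq.1 h.mem]
  have hT2 : ∀ y : L, T q (w^2 * y) = w^2 * T q y := by
    intro y
    simp only [T, mul_pow]
    rw [← pow_mul, mul_comm 2 q, pow_mul, hwq]; ring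
  have hwn : ‖w‖ = 1 := norm_K h.ne
  induction i with
  | zero =>
    apply norm_le_of_T (q := q)
    rw [T_add, hT2, x.T_inv, show t - (0+1) + 1 = t by omega, show t + (0+1) = t + 1 by omega, x.T_succ,
      ← add_mul, norm_mul, norm_inv, mul_inv_le_one_iff_real (x.norm_T_pos t)]
    set e := x.1 t + w with he
    have hxe : x.1 t = w + e := by rw [he, add_comm (x.1 t), ← add_assoc, ch2, zero_add]
    have hen : ‖e‖ = ‖T q (x.1 t)‖ := norm_near h.mem h.near
    have hel : ‖e‖ < 1 := h.near
    rw [← hen]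
    have : x.1 t ^ (q+1) + w ^ 2 = e * (w + w * e^(q-1) + e ^ q) := by
      rw [hxe, pow_succ, add_pow_q, hwq]
      have h1 : e ^ q = e * e^(q-1) := by rw [← pow_succ', Nat.sub_add_cancel (q_pos q)]
      have h2 := ch2 (w^2)
      rw [h1]
      linear_combination h2
    rw [this, norm_mul]
    apply mul_le_of_le_one_right (norm_nonneg _)
    apply norm_add_le_of
    · apply norm_add_le_of hwn.le
      rw [norm_mul, hwn, one_mul, norm_pow]
      exact pow_le_one₀ (norm_nonneg _) hel.le
    · rw [norm_pow]; exact pow_le_one₀ (norm_nonneg _) hel.le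
  | succ i ih =>
    have ih := ih (by omega)
    have hl := (h.large' (n := t + (i+1)) (by omega)).1
    have hs := h.small (t-(i+1)) (by omega)
    have h1 := inv_T_large (q := q) hl
    have h2 := inv_T_small (q := q) (x.ne (t-(i+1))) hs
    apply norm_le_of_T (q := q)
    rw [T_add, hT2, x.T_inv, show t - (i+1+1) + 1 = t-(i+1) by omega, show t + (i+1+1) = t + (i+1) + 1 by omega, x.T_succ]
    set y := x.1 (t+(i+1))
    set z := x.1 (t-(i+1))
    have : y ^ (q+1) * (T q y)⁻¹ + w^2 * (T q z)⁻¹ =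
        (y ^ (q+1) * (T q y)⁻¹ + y) + w ^ 2 * ((T q z)⁻¹ + z⁻¹) + (y + w^2 * z⁻¹) := by
      have e1 := ch2 y
      have e2 := ch2 (w^2 * z⁻¹)
      linear_combination -e1 - e2
    rw [this]
    refine norm_add_le_of (norm_add_le_of h1 ?_) ih
    rw [norm_mul, norm_pow, hwn, one_pow, one_mul]
    exact h2

end ty

end norms
end GSC



namespace GSC
set_option linter.unusedSectionVars false
set_option linter.unusedSimpArgs false

section corr
variable {q : ℕ} [hQ : QP q] {K L : Type} [Field K] [Fintype K] [CharP K 2] [hGS : GS q K]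
  [NormedField L] [IsUltrametricDist L] [IsAlgClosed L] [CharP L 2] [Algebra K L]

variable (q L) in
/-- The functions `χ_t`. -/
def chi (t : ℕ) : S q L → L := ∏ i ∈ Finset.range t, (1 + X q L i ^ (q-1))

variable (q L) in
/-- The summands of the correction. -/
noncomputable def term (n t : ℕ) : S q L → L :=
  chi q L t ^ (q^(2*n)) * X q L t ^ 2 * (fun x => (x.1 (2*t-n))⁻¹)

variable (q L) in
/-- The correction `c_n`. -/
noncomputable def cc (n : ℕ) : S q L → L :=
  ∑ t ∈ Finset.range n, if n ≤ 2 * t then term q L n t else 0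

theorem chi_mem {t n : ℕ} (h : t ≤ n + 1) : chi q L t ∈ A q K L n := by
  apply prod_mem
  intro i hi
  rw [Finset.mem_range] at hi
  exact add_mem (one_mem _) (pow_mem (X_mem (by omega)) _)

theorem cc_mem (n : ℕ) : cc q L (n+1) ∈ A q K L n := by
  apply sum_mem
  intro t ht
  rw [Finset.mem_range] at ht
  split_ifs with h
  · exact mul_mem (mul_mem (pow_mem (chi_mem (by omega)) _) (pow_mem (X_mem (by omega)) _)) (invX_mem (by omega))
  · exact zero_mem _

theorem chi_apply (t : ℕ) (x : S q L) : chi q L t x = ∏ i ∈ Finset.range t, (1 + x.1 i ^ (q-1)) := by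
  simp [chi, X, Finset.prod_apply]

theorem term_apply (n t : ℕ) (x : S q L) :
    term q L n t x = chi q L t x ^ (q^(2*n)) * x.1 t ^ 2 * (x.1 (2*t-n))⁻¹ := rfl

theorem pow_add_qpow (k : ℕ) (y : L) : (1 + y) ^ (q^k) = 1 + y ^ (q^k) := by
  obtain ⟨m, hm, rfl⟩ := hQ.pow
  have : Fact (Nat.Prime 2) := ⟨Nat.prime_two⟩
  rw [← pow_mul, add_pow_char_pow, one_pow]

/-- `χ_t = 1 + small`. -/
theorem chi_near {x : S q L} {t : ℕ} (hσ : ‖T q (x.1 0)‖ < 1) (h : ∀ i < t, ‖x.1 i‖ < 1) :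
    ‖chi q L t x + 1‖ ≤ ‖T q (x.1 0)‖ := by
  rw [chi_apply]
  induction t with
  | zero => simp [ch2]
  | succ t ih =>
    have ih := ih (fun i hi => h i (by omega))
    rw [Finset.prod_range_succ]
    set p := ∏ i ∈ Finset.range t, (1 + x.1 i ^ (q-1))
    have h1 : p * (1 + x.1 t ^ (q-1)) + 1 = (p + 1) + p * x.1 t ^ (q-1) := by ring
    rw [h1]
    apply norm_add_le_of ih
    have hp : ‖p‖ ≤ 1 := by
      have : p = (p + 1) + 1 := by rw [add_assoc, ch2, add_zero]
      rw [this]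
      apply norm_add_le_of (ih.trans hσ.le)
      simp
    rw [norm_mul, norm_pow, x.small_norm h (Nat.lt_succ_self t), ← pow_mul]
    calc ‖p‖ * ‖T q (x.1 0)‖ ^ (q^t * (q-1)) ≤ 1 * ‖T q (x.1 0)‖ ^ 1 := by
          apply mul_le_mul hp _ (by positivity) zero_le_one
          apply pow_le_pow_of_le_one (norm_nonneg _) hσ.le
          have := q_ge q
          exact Nat.mul_pos (pow_pos (q_pos q) _) (by omega)
      _ = _ := by ring

theorem chi_le {x : S q L} {t : ℕ} (hσ : ‖T q (x.1 0)‖ < 1) (h : ∀ i < t, ‖x.1 i‖ < 1) :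
    ‖chi q L t x‖ = 1 := by
  have : chi q L t x = (chi q L t x + 1) + 1 := by rw [add_assoc, ch2, add_zero]
  rw [this, norm_add_right, norm_one]
  rw [norm_one]
  exact (chi_near hσ h).trans_lt hσ

theorem term_small {x : S q L} {n t : ℕ} (hσ : ‖T q (x.1 0)‖ < 1) (h : ∀ i < t + 1, ‖x.1 i‖ < 1)
    (ht : t < n) (_hn : n ≤ 2 * t) : ‖term q L n t x‖ ≤ 1 := by
  rw [term_apply, norm_mul, norm_inv, mul_inv_le_one_iff_real (x.norm_pos _), norm_mul, norm_pow,
    chi_le hσ (fun i hi => h i (by omega)), one_pow, one_mul, norm_pow]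
  rw [x.small_norm h (Nat.lt_succ_self t), x.small_norm h (show 2*t-n < t+1 by omega), ← pow_mul]
  apply pow_le_pow_of_le_one (norm_nonneg _) hσ.le
  calc q ^ (2*t-n) ≤ q ^ t := Nat.pow_le_pow_right (q_pos q) (by omega)
    _ ≤ q ^ t * 2 := by omega

theorem term_eq {x : S q L} {n t : ℕ} {ω : K} (h : x.Ty t ω) (ht : t < n) (_hn : n ≤ 2 * t) :
    ‖term q L n t x + algebraMap K L ω ^ 2 * (x.1 (2*t-n))⁻¹‖ ≤ 1 := by
  rw [term_apply, ← add_mul, norm_mul, norm_inv, mul_inv_le_one_iff_real (x.norm_pos _)]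
  set w := algebraMap K L ω
  have h1 : chi q L t x ^ (q^(2*n)) * x.1 t ^ 2 + w ^ 2 =
      (chi q L t x + 1) ^ (q^(2*n)) * x.1 t ^ 2 + (x.1 t + w) ^ 2 := by
    have e1 : (chi q L t x + 1) ^ (q^(2*n)) = 1 + chi q L t x ^ (q^(2*n)) := by
      rw [add_comm, pow_add_qpow]
    rw [e1]
    have e2 := ch2 (x.1 t ^2)
    have e3 := ch2 (x.1 t * w)
    linear_combination -e2 - e3
  rw [h1, x.small_norm h.small (show 2*t-n < t by omega)]
  apply norm_add_le_of
  · rw [norm_mul, norm_pow, norm_pow, h.norm_t, one_pow, mul_one]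
    calc ‖chi q L t x + 1‖ ^ (q^(2*n)) ≤ ‖T q (x.1 0)‖ ^ (q^(2*n)) :=
          pow_le_pow_left₀ (norm_nonneg _) (chi_near h.lt h.small) _
      _ ≤ _ := pow_le_pow_of_le_one (norm_nonneg _) h.lt.le
          (Nat.pow_le_pow_right (q_pos q) (by omega))
  · rw [norm_pow, h.near_eq, ← pow_mul]
    apply pow_le_pow_of_le_one (norm_nonneg _) h.lt.le
    calc q ^ (2*t-n) ≤ q ^ t := Nat.pow_le_pow_right (q_pos q) (by omega)
      _ ≤ q ^ t * 2 := by omega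

theorem chi_large {x : S q L} {t : ℕ} {ω : K} (h : x.Ty t ω) (j : ℕ) :
    ‖chi q L (t+1+j) x‖ * ‖x.1 (t+1+j)‖ ^ q = 1 := by
  induction j with
  | zero =>
    have h1 := (h.large 0).2
    rw [add_zero, chi_apply, Finset.prod_range_succ, ← chi_apply, norm_mul, chi_le h.lt h.small, one_mul]
    rw [add_zero, zero_add, pow_one] at h1
    have h2 : x.1 t * (1 + x.1 t ^ (q-1)) = T q (x.1 t) := by
      rw [T, mul_add, ← pow_succ', Nat.sub_add_cancel (q_pos q), mul_one, add_comm]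
    have h3 := congrArg norm h2
    rw [norm_mul, h.norm_t, one_mul, x.small_T h.small le_rfl] at h3
    rw [h3, mul_comm]
    exact h1
  | succ j ih =>
    have hl := (h.large j).1
    obtain ⟨h1, h2⟩ := x.step_large hl
    rw [← add_assoc, chi_apply, Finset.prod_range_succ, ← chi_apply, norm_mul, h2]
    have h3 : ‖1 + x.1 (t+1+j) ^ (q-1)‖ = ‖x.1 (t+1+j)‖ ^ (q-1) := by
      rw [norm_add_right, norm_pow]
      rw [norm_one, norm_pow]
      exact one_lt_pow₀ hl (by have := q_ge q; omega)
    rw [h3, mul_assoc, ← pow_succ, Nat.sub_add_cancel (q_pos q), ih]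

theorem term_gt {x : S q L} {n t t' : ℕ} {ω : K} (h : x.Ty t' ω) (ht : t < n) (_hn : n ≤ 2 * t)
    (htt : t' < t) : ‖term q L n t x‖ ≤ 1 := by
  have hc := chi_large h (t - t' - 1)
  rw [show t' + 1 + (t-t'-1) = t by omega] at hc
  obtain ⟨hv, hv2⟩ := h.large' htt
  set v := ‖x.1 t‖
  set σ := ‖T q (x.1 0)‖
  have hv0 : 0 < v := by linarith
  have hA : 1 ≤ q^(2*n) := Nat.one_le_pow _ _ (q_pos q)
  rw [term_apply, norm_mul, norm_inv, mul_inv_le_one_iff_real (x.norm_pos _), norm_mul, norm_pow, norm_pow]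
  have hq := q_ge q
  have e1 : ‖chi q L t x‖ ^ (q^(2*n)) * v ^ (q * q^(2*n)) = 1 := by
    rw [pow_mul v, ← mul_pow, hc, one_pow]
  have e2 : 1 ≤ v ^ (q^(2*n)) * σ ^ (q^(2*t-n)) := by
    have e3 : v ^ (q^(2*n)) * σ ^ (q^(2*n-(t-t') + t')) = 1 := by
      have : 2*n = (t-t') + (2*n-(t-t')) := by omega
      nth_rewrite 1 [this]
      rw [pow_add q, pow_mul, pow_add q (2*n-(t-t')), mul_comm (q ^ (2*n-(t-t'))) (q^t'), pow_mul, ← mul_pow, hv2, one_pow]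
    rw [← e3]
    apply mul_le_mul_of_nonneg_left _ (by positivity)
    apply pow_le_pow_of_le_one (norm_nonneg _) h.lt.le
    exact Nat.pow_le_pow_right (q_pos q) (by omega)
  have hlow := h.lower (2*t-n)
  have hcc : 0 ≤ ‖chi q L t x‖ ^ (q^(2*n)) := by positivity
  calc ‖chi q L t x‖ ^ (q^(2*n)) * v ^ 2
      ≤ ‖chi q L t x‖ ^ (q^(2*n)) * v ^ 2 * (v ^ (q^(2*n)) * σ ^ (q^(2*t-n))) :=
        le_mul_of_one_le_right (by positivity) e2
    _ = (‖chi q L t x‖ ^ (q^(2*n)) * v ^ (2 + q^(2*n))) * σ ^ (q^(2*t-n)) := by ring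
    _ ≤ (‖chi q L t x‖ ^ (q^(2*n)) * v ^ (q * q^(2*n))) * σ ^ (q^(2*t-n)) := by
        apply mul_le_mul_of_nonneg_right _ (by positivity)
        apply mul_le_mul_of_nonneg_left _ hcc
        apply pow_le_pow_right₀ hv.le
        nlinarith
    _ = σ ^ (q^(2*t-n)) := by rw [e1, one_mul]
    _ ≤ _ := hlow

theorem norm_sum_le_one {ι : Type} {s : Finset ι} {g : ι → L} (h : ∀ i ∈ s, ‖g i‖ ≤ 1) :
    ‖∑ i ∈ s, g i‖ ≤ 1 :=
  IsUltrametricDist.norm_sum_le_of_forall_le_of_nonneg zero_le_one h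

theorem cc_apply (n : ℕ) (x : S q L) :
    cc q L n x = ∑ t ∈ Finset.range n, if n ≤ 2 * t then term q L n t x else 0 := by
  rw [cc, Finset.sum_apply]
  apply Finset.sum_congr rfl
  intro t _
  split_ifs <;> rfl

/-- Away from the mirror case the correction is integral. -/
theorem cc_le {x : S q L} {n : ℕ} (hσ : ‖T q (x.1 0)‖ < 1)
    (h : (∀ i, ‖x.1 i‖ < 1) ∨ ∃ t, ∃ ω : K, x.Ty t ω ∧ (n ≤ t ∨ 2 * t < n)) : ‖cc q L n x‖ ≤ 1 := by
  rw [cc_apply]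
  apply norm_sum_le_one
  intro t ht
  rw [Finset.mem_range] at ht
  split_ifs with hn
  swap
  · simp
  rcases h with h | ⟨t', ω, h, h2⟩
  · exact term_small hσ (fun i _ => h i) ht hn
  · rcases lt_trichotomy t t' with h3 | h3 | h3
    · exact term_small hσ (fun i hi => h.small i (by omega)) ht hn
    · omega
    · exact term_gt h ht hn h3

theorem cc_mirror {x : S q L} {n t : ℕ} {ω : K} (h : x.Ty t ω) (ht : t < n) (hn : n ≤ 2 * t) :
    ‖cc q L n x + algebraMap K L ω ^ 2 * (x.1 (2*t-n))⁻¹‖ ≤ 1 := by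
  rw [cc_apply, ← Finset.add_sum_erase _ _ (Finset.mem_range.2 ht), if_pos hn, add_right_comm]
  apply norm_add_le_of (term_eq h ht hn)
  apply norm_sum_le_one
  intro t' ht'
  rw [Finset.mem_erase, Finset.mem_range] at ht'
  split_ifs with hn'
  swap
  · simp
  rcases lt_trichotomy t t' with h3 | h3 | h3
  · exact term_gt h ht'.2 hn' h3
  · omega
  · exact term_small h.lt (fun i hi => h.small i (by omega)) ht'.2 hn'

variable (q L) in
/-- The local parameterising functions `u_n`. -/
noncomputable def u (n : ℕ) : S q L → L := X q L n + cc q L n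

theorem u_le_mirror {x : S q L} {n t : ℕ} {ω : K} (h : x.Ty t ω) (hn : n ≤ 2 * t) : ‖u q L n x‖ ≤ 1 := by
  change ‖x.1 n + cc q L n x‖ ≤ 1
  rcases lt_or_ge t n with ht | ht
  · have h1 := cc_mirror h ht hn
    have h2 := h.mirror (i := n - t - 1) (by omega)
    rw [show t + (n-t-1+1) = n by omega, show t - (n-t-1+1) = 2*t-n by omega] at h2
    have h3 := norm_add_le_of h1 h2
    convert h3 using 2
    have := ch2 (algebraMap K L ω ^ 2 * (x.1 (2 * t - n))⁻¹)
    linear_combination -this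
  · apply norm_add_le_of
    · rcases ht.lt_or_eq with ht | rfl
      · exact (h.small n ht).le
      · exact h.norm_t.le
    · exact cc_le h.lt (Or.inr ⟨t, ω, h, Or.inl ht⟩)

theorem u_le_B {x : S q L} {n : ℕ} (h : ∀ i, ‖x.1 i‖ < 1) : ‖u q L n x‖ ≤ 1 := by
  change ‖x.1 n + cc q L n x‖ ≤ 1
  have hσ : ‖T q (x.1 0)‖ < 1 := by rw [norm_T_small (h 0)]; exact h 0
  apply norm_add_le_of (h n).le
  obtain (h2 | h2) : (∀ i, ‖x.1 i‖ < 1) ∨ False := Or.inl h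
  · rw [cc_apply]
    apply norm_sum_le_one
    intro t ht
    rw [Finset.mem_range] at ht
    split_ifs with hn
    · exact term_small hσ (fun i _ => h i) ht hn
    · simp
  · exact h2.elim

theorem u_large {x : S q L} {n t : ℕ} {ω : K} (h : x.Ty t ω) (hn : 2 * t < n) :
    1 < ‖u q L n x‖ ∧ ‖u q L n x‖ ^ (q^(n-2*t)) * ‖T q (x.1 0)‖ = 1 := by
  have h1 := (h.large' (n := n) (by omega)).1
  have h2 : ‖u q L n x‖ = ‖x.1 n‖ := by
    change ‖x.1 n + cc q L n x‖ = _
    apply norm_add_left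
    exact (cc_le h.lt (Or.inr ⟨t, ω, h, Or.inr hn⟩)).trans_lt h1
  rw [h2]
  exact ⟨h1, h.root hn⟩

end corr
end GSC



namespace GSC
set_option linter.unusedSectionVars false
set_option linter.unusedSimpArgs false

section vg
variable {q : ℕ} [hQ : QP q] {K L : Type} [Field K] [Fintype K] [CharP K 2] [hGS : GS q K]
  [NormedField L] [IsUltrametricDist L] [IsAlgClosed L] [CharP L 2] [Algebra K L]

theorem norm_algClosure {c : L} (hc : c ∈ algebraicClosure K L) (h0 : c ≠ 0) : ‖c‖ = 1 := by
  have h1 : IsIntegral K c := (mem_algebraicClosure_iff.1 hc).isIntegral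
  have := IntermediateField.adjoin.finiteDimensional h1
  have hf : Finite (IntermediateField.adjoin K {c}) := Module.finite_of_finite K
  let g : (IntermediateField.adjoin K {c})ˣ :=
    Units.mk0 ⟨c, IntermediateField.mem_adjoin_simple_self K c⟩ (by
      intro h; exact h0 (congrArg Subtype.val h))
  have h2 : IsOfFinOrder g := isOfFinOrder_of_finite g
  obtain ⟨n, hn, h3⟩ := isOfFinOrder_iff_pow_eq_one.1 h2
  have h4 := congrArg (fun z : (IntermediateField.adjoin K {c})ˣ => ((z : IntermediateField.adjoin K {c}) : L)) h3
  simp only [Units.val_pow_eq_pow_val, Units.val_one] at h4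
  exact norm_fin_order hn.ne' (by simpa [g] using h4)

theorem algClosure_T {c : L} (hc : c ∈ algebraicClosure K L) :
    ∃ c0 ∈ algebraicClosure K L, T q c0 = c := by
  have := algebraicClosure.isAlgClosure K L
  have : IsAlgClosed (algebraicClosure K L) := IsAlgClosure.isAlgClosed K
  have : CharP (algebraicClosure K L) 2 := charP_of_injective_algebraMap (algebraMap K (algebraicClosure K L)).injective 2
  obtain ⟨y, hy⟩ := exists_T_eq_L (q := q) (L := algebraicClosure K L) ⟨c, hc⟩
  exact ⟨y.1, y.2, by simpa [T] using congrArg Subtype.val hy⟩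

variable (K) in
/-- `y` has a leading term `c s^j`. -/
def Ld (s y : L) : Prop := ∃ c ∈ algebraicClosure K L, c ≠ 0 ∧ ∃ j : ℤ, ‖y - c * s ^ j‖ < ‖y‖

theorem norm_eq_of_sub_lt {y m : L} (h : ‖y - m‖ < ‖y‖) : ‖m‖ = ‖y‖ := by
  have h1 : m = y + -(y - m) := by ring
  rw [h1, norm_add_left]
  rwa [norm_neg]

theorem Ld.norm {s y : L} (h : Ld K s y) : ∃ j : ℤ, ‖y‖ = ‖s‖ ^ j := by
  obtain ⟨c, hc, h0, j, hj⟩ := h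
  refine ⟨j, ?_⟩
  rw [← norm_eq_of_sub_lt hj, norm_mul, norm_algClosure hc h0, one_mul, norm_zpow]

theorem Ld.mul {s y z : L} (hs : s ≠ 0) (hy : Ld K s y) (hz : Ld K s z) : Ld K s (y * z) := by
  obtain ⟨c, hc, h0, j, hj⟩ := hy
  obtain ⟨c', hc', h0', j', hj'⟩ := hz
  refine ⟨c * c', mul_mem hc hc', mul_ne_zero h0 h0', j + j', ?_⟩
  rw [zpow_add₀ hs]
  have h1 : y * z - c * c' * (s ^ j * s ^ j') = (y - c * s ^ j) * z + (c * s^j) * (z - c' * s ^ j') := by ring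
  have hzp : 0 < ‖z‖ := (norm_nonneg _).trans_lt hj'
  have hyp : 0 < ‖y‖ := (norm_nonneg _).trans_lt hj
  rw [h1, norm_mul y z]
  apply norm_add_lt_of
  · rw [norm_mul]; exact mul_lt_mul_of_pos_right hj hzp
  · rw [norm_mul, norm_eq_of_sub_lt hj]; exact mul_lt_mul_of_pos_left hj' hyp

theorem Ld.inv {s y : L} (hs : s ≠ 0) (hy : Ld K s y) : Ld K s y⁻¹ := by
  obtain ⟨c, hc, h0, j, hj⟩ := hy
  refine ⟨c⁻¹, inv_mem hc, inv_ne_zero h0, -j, ?_⟩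
  rw [zpow_neg, ← mul_inv]
  have hyp : 0 < ‖y‖ := (norm_nonneg _).trans_lt hj
  have hy0 : y ≠ 0 := norm_pos_iff.1 hyp
  have hm : c * s ^ j ≠ 0 := mul_ne_zero h0 (zpow_ne_zero _ hs)
  have h1 : y⁻¹ - (c * s ^ j)⁻¹ = -(y - c * s ^ j) * (y * (c * s^j))⁻¹ := by
    field_simp; ring
  rw [h1, norm_mul, norm_neg, norm_inv, norm_mul, norm_eq_of_sub_lt hj, norm_inv, ← div_eq_mul_inv,
    div_lt_iff₀ (by positivity)]
  rw [← mul_assoc, inv_mul_cancel₀ hyp.ne', one_mul]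
  exact hj

open Polynomial in
theorem Ld_poly {s : L} (hs : s ≠ 0) (hs1 : ‖s‖ < 1) (p : (algebraicClosure K L)[X]) :
    (p ≠ 0 → Ld K s (aeval s p)) ∧ ‖aeval s p‖ ≤ 1 := by
  have hpt : ‖s‖ > 0 := norm_pos_iff.2 hs
  have hle : ∀ p : (algebraicClosure K L)[X], ‖aeval s p‖ ≤ 1 := by
    intro p
    rw [aeval_eq_sum_range]
    apply norm_sum_le_one
    intro i _
    rw [Algebra.smul_def, norm_mul, norm_pow]
    apply mul_le_one₀ _ (by positivity) (pow_le_one₀ (norm_nonneg _) hs1.le)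
    by_cases h : p.coeff i = 0
    · simp [h]
    · exact (norm_algClosure (p.coeff i).2 (by simpa using h)).le
  refine ⟨?_, hle p⟩
  refine recOnHorner (M := fun p => p ≠ 0 → Ld K s (aeval s p)) p (fun h => absurd rfl h) ?_ ?_
  · intro p a hp ha _ _
    have ha' : (a : L) ≠ 0 := by simpa using ha
    have han := norm_algClosure a.2 ha'
    have h1 : aeval s p = s * aeval s p.divX := by
      conv_lhs => rw [← divX_mul_X_add p, hp]
      simp [mul_comm]
    have h2 : ‖aeval s p‖ < 1 := by
      rw [h1, norm_mul]
      calc ‖s‖ * ‖aeval s p.divX‖ ≤ ‖s‖ * 1 := mul_le_mul_of_nonneg_left (hle _) hpt.le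
        _ < 1 := by linarith
    refine ⟨a, a.2, ha', 0, ?_⟩
    have h3 : aeval s (p + C a) = aeval s p + (a : L) := by
      simp
    rw [h3, zpow_zero, mul_one, add_sub_cancel_right, norm_add_right, han]
    · exact h2
    · rw [han]; exact h2
  · intro p hp ih _
    rw [map_mul, aeval_X]
    refine (ih hp).mul hs ⟨1, one_mem _, one_ne_zero, 1, ?_⟩
    simpa using hs

variable (K) in
/-- The closure of the field generated by `s` over the constants. -/
noncomputable def CF (s : L) : Subfield L :=
  (IntermediateField.adjoin (algebraicClosure K L) {s}).toSubfield.topologicalClosure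

theorem CF_self (s : L) : s ∈ CF K s :=
  Subfield.le_topologicalClosure _ (IntermediateField.mem_adjoin_simple_self _ s)

theorem CF_const (s : L) {c : L} (hc : c ∈ algebraicClosure K L) : c ∈ CF K s :=
  Subfield.le_topologicalClosure _
    ((IntermediateField.adjoin (algebraicClosure K L) {s}).algebraMap_mem ⟨c, hc⟩)

theorem CF_K (s : L) (c : K) : algebraMap K L c ∈ CF K s :=
  CF_const s ((algebraicClosure K L).algebraMap_mem c)

theorem CF_closed (s y : L) (h : ∀ ε > 0, ∃ z ∈ CF K s, ‖y - z‖ < ε) : y ∈ CF K s := by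
  have h1 : y ∈ closure ((CF K s : Subfield L) : Set L) := by
    rw [Metric.mem_closure_iff]
    intro ε hε
    obtain ⟨z, hz, h2⟩ := h ε hε
    exact ⟨z, hz, by rwa [dist_eq_norm]⟩
  have hc : IsClosed ((CF K s : Subfield L) : Set L) := Subfield.isClosed_topologicalClosure _
  rw [hc.closure_eq] at h1
  exact h1

theorem CF_Ld {s y : L} (hs : s ≠ 0) (hs1 : ‖s‖ < 1) (hy : y ∈ CF K s) (h0 : y ≠ 0) : Ld K s y := by
  have h1 : y ∈ closure ((IntermediateField.adjoin (algebraicClosure K L) {s}).toSubfield : Set L) := hy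
  rw [Metric.mem_closure_iff] at h1
  obtain ⟨z, hz, h2⟩ := h1 ‖y‖ (norm_pos_iff.2 h0)
  rw [dist_eq_norm] at h2
  have h3 := norm_eq_of_sub_lt h2
  have hz0 : z ≠ 0 := by rw [← norm_pos_iff, h3, norm_pos_iff]; exact h0
  have hz' : z ∈ IntermediateField.adjoin (algebraicClosure K L) {s} := hz
  rw [IntermediateField.mem_adjoin_simple_iff] at hz'
  obtain ⟨r, p, rfl⟩ := hz'
  have hr : r ≠ 0 := by rintro rfl; simp at hz0
  have hp : p ≠ 0 := by rintro rfl; simp at hz0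
  have h4 : Ld K s (Polynomial.aeval s r / Polynomial.aeval s p) := by
    rw [div_eq_mul_inv]
    exact ((Ld_poly hs hs1 r).1 hr).mul hs (((Ld_poly hs hs1 p).1 hp).inv hs)
  obtain ⟨c, hc, hc0, j, hj⟩ := h4
  refine ⟨c, hc, hc0, j, ?_⟩
  rw [h3] at hj
  have := norm_add_lt_of h2 hj
  convert this using 2
  ring

theorem CF_T_small {s z e : L} (hz : z ∈ CF K s) (he : T q e = z) (h1 : ‖e‖ < 1) : e ∈ CF K s := by
  have h2 : ∀ n : ℕ, ∃ w ∈ CF K s, ‖e - w‖ ≤ ‖e‖ ^ (q^n) := by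
    intro n
    induction n with
    | zero => exact ⟨0, zero_mem _, by simp⟩
    | succ n ih =>
      obtain ⟨w, hw, hn⟩ := ih
      refine ⟨z - w ^ q, sub_mem hz (pow_mem hw q), ?_⟩
      have : e - (z - w ^ q) = -(e - w) ^ q := by
        rw [ch2_sub e w, add_pow_q, ← he, T, ch2_sub, ch2_sub]
        have e1 := ch2 e
        have e2 := ch2 (e^q)
        have e3 := ch2 (w^q)
        linear_combination e1 + e2 + e3
      rw [this, norm_neg, norm_pow, pow_succ, pow_mul]
      exact pow_le_pow_left₀ (norm_nonneg _) hn q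
  apply CF_closed
  intro ε hε
  obtain ⟨n, hn⟩ := exists_pow_lt_of_lt_one hε h1
  obtain ⟨w, hw, h3⟩ := h2 n
  refine ⟨w, hw, h3.trans_lt (lt_of_le_of_lt ?_ hn)⟩
  apply pow_le_pow_of_le_one (norm_nonneg _) h1.le
  exact (Nat.lt_pow_self (by have := q_ge q; omega)).le

theorem CF_T {s z e : L} (hs : s ≠ 0) (hs1 : ‖s‖ < 1) (hz : z ∈ CF K s) (he : T q e = z) (h1 : ‖e‖ ≤ 1) :
    e ∈ CF K s := by
  have hz1 : ‖z‖ ≤ 1 := by rw [← he]; exact norm_T_le h1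
  obtain ⟨c, hc, hcz⟩ : ∃ c ∈ algebraicClosure K L, ‖z - c‖ < 1 := by
    rcases hz1.lt_or_eq with h | h
    · exact ⟨0, zero_mem _, by simpa using h⟩
    · have hz0 : z ≠ 0 := by rw [← norm_pos_iff, h]; norm_num
      obtain ⟨c, hc, h0, j, hj⟩ := CF_Ld hs hs1 hz hz0
      have h2 := norm_eq_of_sub_lt hj
      rw [norm_mul, norm_algClosure hc h0, one_mul, h, norm_zpow] at h2
      have hj0 : j = 0 := zpow_right_injective₀ (norm_pos_iff.2 hs) hs1.ne (by simpa using h2)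
      refine ⟨c, hc, ?_⟩
      rw [hj0, zpow_zero, mul_one, h] at hj
      exact hj
  obtain ⟨c0, hc0, hT⟩ := algClosure_T (q := q) hc
  have h3 : ‖T q (e - c0)‖ < 1 := by rwa [T_sub, he, hT]
  obtain ⟨ω, hω, hn⟩ := near_of_T K h3
  have h4 : e - c0 + algebraMap K L ω ∈ CF K s := by
    refine CF_T_small (q := q) (z := z - c) (sub_mem hz (CF_const s hc)) ?_ hn
    rw [T_add_Fq hω, T_sub, he, hT]
  have h5 : e = (e - c0 + algebraMap K L ω) + c0 - algebraMap K L ω := by ring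
  rw [h5]
  exact sub_mem (add_mem h4 (CF_const s hc0)) (CF_K s ω)

/-- At a point of type `t` all functions of level `2t` lie in a discretely valued field. -/
theorem S.Ty.base {x : S q L} {t : ℕ} {ω : K} (h : x.Ty t ω) :
    ∃ s : L, s ≠ 0 ∧ ‖s‖ = ‖T q (x.1 0)‖ ∧ ∀ a ∈ A q K L (2*t), a x ∈ CF K s := by
  obtain ⟨s, hsn, h0⟩ : ∃ s : L, ‖s‖ = ‖T q (x.1 0)‖ ∧ x.1 0 ∈ CF K s := by
    rcases Nat.eq_zero_or_pos t with rfl | ht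
    · refine ⟨x.1 0 + algebraMap K L ω, by simpa using h.near_eq, ?_⟩
      have h1 := CF_self (K := K) (x.1 0 + algebraMap K L ω)
      have h2 := sub_mem h1 (CF_K (x.1 0 + algebraMap K L ω) ω)
      simpa using h2
    · exact ⟨x.1 0, by simpa using x.small_norm h.small ht, CF_self _⟩
  have hs1 : ‖s‖ < 1 := by rw [hsn]; exact h.lt
  have hs : s ≠ 0 := by rw [← norm_pos_iff, hsn]; exact h.T_pos
  refine ⟨s, hs, hsn, ?_⟩
  have memT : ∀ {y : L}, y ∈ CF K s → T q y ∈ CF K s := fun hy => add_mem (pow_mem hy q) hy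
  have nextT : ∀ i, x.1 i ∈ CF K s → T q (x.1 (i+1)) ∈ CF K s := by
    intro i hi
    rw [x.T_succ]
    exact mul_mem (pow_mem hi _) (inv_mem (memT hi))
  have low : ∀ i ≤ t, x.1 i ∈ CF K s := by
    intro i
    induction i with
    | zero => intro _; exact h0
    | succ i ih =>
      intro hi
      refine CF_T (q := q) hs hs1 (nextT i (ih (by omega))) rfl ?_
      rcases hi.lt_or_eq with hi | hi
      · exact (h.small _ hi).le
      · rw [hi, h.norm_t]
  have high : ∀ i ≤ t, x.1 (t+i) ∈ CF K s := by
    intro i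
    induction i with
    | zero => intro _; exact low t le_rfl
    | succ i ih =>
      intro hi
      have h1 := h.mirror hi
      have h3 : algebraMap K L ω ^ 2 * (x.1 (t-(i+1)))⁻¹ ∈ CF K s :=
        mul_mem (pow_mem (CF_K s ω) 2) (inv_mem (low _ (by omega)))
      have h2 := CF_T (q := q) hs hs1 (e := x.1 (t+(i+1)) + algebraMap K L ω ^ 2 * (x.1 (t-(i+1)))⁻¹)
        (z := T q (x.1 (t+(i+1))) + T q (algebraMap K L ω ^ 2 * (x.1 (t-(i+1)))⁻¹))
        (add_mem (nextT (t+i) (ih (by omega))) (memT h3)) (T_add _ _) h1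
      have h4 := sub_mem h2 h3
      simpa using h4
  have all : ∀ i ≤ 2 * t, x.1 i ∈ CF K s := by
    intro i hi
    rcases le_total i t with h1 | h1
    · exact low i h1
    · have := high (i - t) (by omega)
      rwa [show t + (i - t) = i by omega] at this
  intro a ha
  induction ha using Algebra.adjoin_induction with
  | mem f hf =>
    rcases hf with rfl | ⟨i, hi, rfl⟩
    · exact inv_mem (memT h0)
    · exact all i hi
  | algebraMap r => exact CF_K s r
  | add f g _ _ hf hg => exact add_mem hf hg
  | mul f g _ _ hf hg => exact mul_mem hf hg

/-- Value groups. -/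
theorem S.Ty.value {x : S q L} {t : ℕ} {ω : K} (h : x.Ty t ω) (d : ℕ) :
    ∀ τ : ℝ, 0 < τ → τ ^ (q^d) = ‖T q (x.1 0)‖ → ∀ a ∈ A q K L (2*t+d), a x = 0 ∨ ∃ j : ℤ, ‖a x‖ = τ ^ j := by
  induction d with
  | zero =>
    intro τ hτ hτ2 a ha
    obtain ⟨s, hs, hsn, hA⟩ := h.base
    rw [pow_zero, pow_one] at hτ2
    by_cases h0 : a x = 0
    · exact Or.inl h0
    · right
      rw [hτ2, ← hsn]
      exact (CF_Ld hs (by rw [hsn]; exact h.lt) (hA a ha) h0).norm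
  | succ d ih =>
    intro τ hτ hτ2 a ha
    obtain ⟨b, hb, rfl⟩ := expand (n := 2*t+d) (cc_mem (q := q) (2*t+d)) ha
    obtain ⟨hu1, hu2⟩ := u_large (n := 2*t+d+1) h (by omega)
    have hu3 : ‖u q L (2*t+d+1) x‖ = τ⁻¹ := by
      rw [show 2*t+d+1 - 2*t = d+1 by omega, ← hτ2, ← mul_pow] at hu2
      have := (pow_eq_one_iff_of_nonneg (by positivity) (pow_pos (q_pos q) (d+1)).ne').1 hu2
      exact eq_inv_of_mul_eq_one_left this
    have hτ1 : τ⁻¹ ≠ 1 := by rw [← hu3]; exact hu1.ne'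
    have h1 := sum_digits (q := q) (ρ := τ⁻¹) (inv_pos.2 hτ) hτ1 hu3 (fun k => b k x) (by
      intro k hk
      rcases ih (τ^q) (pow_pos hτ q) (by rw [← hτ2, ← pow_mul, ← pow_succ']) (b k) (hb k) with h0 | ⟨j, hj⟩
      · exact Or.inl h0
      · right
        refine ⟨-j, ?_⟩
        rw [hj, ← zpow_natCast, ← zpow_mul, inv_zpow', mul_neg, neg_neg])
    have h2 : (∑ k ∈ Finset.range q, b k * (X q L (2*t+d+1) + cc q L (2*t+d+1)) ^ k) x =
        ∑ k ∈ Finset.range q, b k x * u q L (2*t+d+1) x ^ k := by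
      rw [Finset.sum_apply]; rfl
    rw [h2]
    refine h1.2.imp_right ?_
    rintro ⟨k, hk, j, -, -, hj⟩
    exact ⟨-((q:ℤ)*j+k), by rw [hj, inv_zpow']⟩

variable (K) in
/-- The local lemma. -/
theorem loc {x : S q L} (hσ : ‖T q (x.1 0)‖ < 1) (n : ℕ) :
    ‖u q L (n+1) x‖ ≤ 1 ∨ ∃ ρ : ℝ, 1 < ρ ∧ ‖u q L (n+1) x‖ = ρ ∧
      (∃ e : ℕ, 0 < e ∧ ‖T q (x.1 0)‖ = ρ ^ (-((q:ℤ) * e))) ∧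
      ∀ a ∈ A q K L n, a x = 0 ∨ ∃ j : ℤ, ‖a x‖ = ρ ^ ((q:ℤ) * j) := by
  rcases x.trichotomy K hσ with h | ⟨t, ω, h⟩
  · exact Or.inl (u_le_B h)
  rcases Nat.lt_or_ge (2*t) (n+1) with hn | hn
  swap
  · exact Or.inl (u_le_mirror h hn)
  right
  obtain ⟨h1, h2⟩ := u_large h hn
  refine ⟨_, h1, rfl, ?_, ?_⟩
  · refine ⟨q^(n-2*t), pow_pos (q_pos q) _, ?_⟩
    rw [zpow_neg]
    apply eq_inv_of_mul_eq_one_right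
    rw [show n + 1 - 2*t = n - 2*t + 1 by omega, pow_succ'] at h2
    exact_mod_cast h2
  · intro a ha
    have h3 := h.value (n - 2*t) ((‖u q L (n+1) x‖⁻¹)^q) (by positivity) (by
      rw [← pow_mul, ← pow_succ', inv_pow, show n - 2*t + 1 = n + 1 - 2*t by omega]
      exact (eq_inv_of_mul_eq_one_right h2).symm) a (by rwa [show 2*t + (n-2*t) = n by omega])
    refine h3.imp_right ?_
    rintro ⟨j, hj⟩
    refine ⟨-j, ?_⟩
    rw [hj, ← zpow_natCast, ← zpow_mul, inv_zpow', mul_neg]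

end vg
end GSC



namespace GSC
set_option linter.unusedSectionVars false
set_option linter.unusedSimpArgs false

section MM
variable {q : ℕ} [hQ : QP q] {K L : Type} [Field K] [Fintype K] [CharP K 2] [hGS : GS q K]
  [NormedField L] [IsUltrametricDist L] [IsAlgClosed L] [CharP L 2] [Algebra K L]

variable (q K L) in
/-- The module of functions with poles bounded away from infinity. -/
def M (n : ℕ) : Submodule K (S q L → L) where
  carrier := {f | f ∈ A q K L n ∧ ∀ x : S q L, ‖T q (x.1 0)‖ < 1 → ‖T q (x.1 0) * f x‖ < 1}
  add_mem' := by
    rintro f g ⟨hf, hf2⟩ ⟨hg, hg2⟩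
    refine ⟨add_mem hf hg, fun x hx => ?_⟩
    rw [Pi.add_apply, mul_add]
    exact norm_add_lt_of (hf2 x hx) (hg2 x hx)
  zero_mem' := ⟨zero_mem _, fun x _ => by simp⟩
  smul_mem' := by
    rintro c f ⟨hf, hf2⟩
    refine ⟨Subalgebra.smul_mem _ hf c, fun x hx => ?_⟩
    rw [Pi.smul_apply, Algebra.smul_def, mul_left_comm, norm_mul]
    exact (mul_le_of_le_one_left (norm_nonneg _) (norm_K_le c)).trans_lt (hf2 x hx)

theorem mem_M {n : ℕ} {f : S q L → L} : f ∈ M q K L n ↔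
    f ∈ A q K L n ∧ ∀ x : S q L, ‖T q (x.1 0)‖ < 1 → ‖T q (x.1 0) * f x‖ < 1 := Iff.rfl

theorem T0_mul_M {n : ℕ} {f g : S q L → L} (hf : f ∈ M q K L n) (hg : g ∈ M q K L n) :
    T0 q L * (f * g) ∈ M q K L n := by
  refine ⟨mul_mem (T0_mem n) (mul_mem hf.1 hg.1), fun x hx => ?_⟩
  simp only [Pi.mul_apply, T0]
  have h1 : T q (x.1 0) * (T q (x.1 0) * (f x * g x)) = (T q (x.1 0) * f x) * (T q (x.1 0) * g x) := by ring
  rw [h1, norm_mul]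
  exact mul_lt_one_of_nonneg_of_lt_one_left (norm_nonneg _) (hf.2 x hx) (hg.2 x hx).le

theorem T0_M {n : ℕ} {f : S q L → L} (hf : f ∈ M q K L n) : T0 q L * f ∈ M q K L n := by
  refine ⟨mul_mem (T0_mem n) hf.1, fun x hx => ?_⟩
  simp only [Pi.mul_apply, T0]
  rw [norm_mul]
  exact mul_lt_one_of_nonneg_of_lt_one_left (norm_nonneg _) hx (hf.2 x hx).le

theorem T0_pow_M {n : ℕ} {f : S q L → L} (hf : f ∈ M q K L n) (k : ℕ) : T0 q L ^ k * f ∈ M q K L n := by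
  induction k with
  | zero => simpa using hf
  | succ k ih => rw [pow_succ', mul_assoc]; exact T0_M ih

open Polynomial in
theorem small_coeff (s : Finset L) (hs : ∀ a ∈ s, ‖a‖ ≤ 1) (hd : ∀ a ∈ s, ∀ b ∈ s, a ≠ b → ‖a - b‖ = 1)
    (p : L[X]) (hp : p.degree < s.card) (hv : ∀ a ∈ s, ‖p.eval a‖ < 1) (k : ℕ) : ‖p.coeff k‖ < 1 := by
  classical
  induction s using Finset.induction_on generalizing p k with
  | empty =>
    simp at hp
    simp [hp]
  | insert a s ha ih =>
    set g := p /ₘ (Polynomial.X - C a) with hg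
    have h1 : p = C (p.eval a) + (Polynomial.X - C a) * g := by
      have := modByMonic_add_div p (Polynomial.X - C a)
      rw [modByMonic_X_sub_C_eq_C_eval] at this
      exact this.symm
    have hpa := hv a (Finset.mem_insert_self _ _)
    have hg1 : ∀ k, ‖g.coeff k‖ < 1 := by
      apply ih (fun b hb => hs b (Finset.mem_insert_of_mem hb))
        (fun b hb c hc => hd b (Finset.mem_insert_of_mem hb) c (Finset.mem_insert_of_mem hc))
      · by_cases hp0 : p = 0
        · rw [hg, hp0, zero_divByMonic, degree_zero]; exact WithBot.bot_lt_coe _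
        rw [Finset.card_insert_of_notMem ha] at hp
        by_cases hpd : p.degree < (Polynomial.X - C a).degree
        · rw [hg, (divByMonic_eq_zero_iff (monic_X_sub_C a)).2 hpd, degree_zero]; exact WithBot.bot_lt_coe _
        push Not at hpd
        have h2 := degree_add_divByMonic (monic_X_sub_C a) hpd
        rw [← h2, degree_X_sub_C, ← hg] at hp
        by_cases hg0 : g = 0
        · rw [hg0, degree_zero]; exact WithBot.bot_lt_coe _
        rw [degree_eq_natDegree hg0] at hp ⊢
        norm_cast at hp ⊢
        omega
      · intro b hb
        have hab : b ≠ a := fun e => ha (e ▸ hb)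
        have hn := hd b (Finset.mem_insert_of_mem hb) a (Finset.mem_insert_self _ _) hab
        have h3 := congrArg (Polynomial.eval b) h1
        simp only [eval_add, eval_mul, eval_sub, eval_X, eval_C] at h3
        have h4 : ‖(b - a) * g.eval b‖ < 1 := by
          have : (b - a) * g.eval b = p.eval b + -p.eval a := by rw [h3]; ring
          rw [this]
          exact norm_add_lt_of (hv b (Finset.mem_insert_of_mem hb)) (by rwa [norm_neg])
        rwa [norm_mul, hn, one_mul] at h4
    have ha1 := hs a (Finset.mem_insert_self _ _)
    have hag : ∀ k, ‖a * g.coeff k‖ < 1 := by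
      intro k
      rw [norm_mul]
      exact (mul_le_of_le_one_left (norm_nonneg _) ha1).trans_lt (hg1 k)
    rw [h1, sub_mul]
    cases k with
    | zero =>
      simp only [coeff_add, coeff_sub, coeff_C_zero, mul_coeff_zero, coeff_X_zero, zero_mul, zero_sub, coeff_C_mul]
      exact norm_add_lt_of hpa (by rw [norm_neg]; exact hag 0)
    | succ k =>
      simp only [coeff_add, coeff_sub, coeff_C_succ, coeff_X_mul, coeff_C_mul, zero_add]
      rw [sub_eq_add_neg]
      exact norm_add_lt_of (hg1 k) (by rw [norm_neg]; exact hag (k+1))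

theorem u_mv (n : ℕ) (x : S q L) {β : K} (hβ : β ∈ Fq q K) :
    u q L (n+1) (mv n x β) = u q L (n+1) x + algebraMap K L β := by
  change (mv n x β).1 (n+1) + cc q L (n+1) (mv n x β) = x.1 (n+1) + cc q L (n+1) x + _
  rw [mv_succ n x hβ, A_congr (cc_mem (K := K) n) (fun i hi => mv_le n x β hi)]
  ring

theorem A_mv {n : ℕ} {a : S q L → L} (ha : a ∈ A q K L n) (x : S q L) (β : K) : a (mv n x β) = a x :=
  A_congr ha (fun _ hi => mv_le n x β hi)

theorem usum_apply (n : ℕ) (a : ℕ → S q L → L) (x : S q L) :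
    (∑ k ∈ Finset.range q, a k * u q L n ^ k) x = ∑ k ∈ Finset.range q, a k x * u q L n x ^ k := by
  rw [Finset.sum_apply]; rfl

theorem expand_u {n : ℕ} {f : S q L → L} (hf : f ∈ A q K L (n+1)) :
    ∃ a : ℕ → S q L → L, (∀ k, a k ∈ A q K L n) ∧ f = ∑ k ∈ Finset.range q, a k * u q L (n+1) ^ k :=
  expand (cc_mem n) hf

theorem u_mem (n : ℕ) : u q L (n+1) ∈ A q K L (n+1) :=
  add_mem (X_mem le_rfl) (A_mono (Nat.le_succ n) (cc_mem n))

/-- Decomposition, easy direction. -/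
theorem M_of_coeff {n : ℕ} {a : ℕ → S q L → L} (ha : ∀ k < q, a k ∈ M q K L n) :
    ∑ k ∈ Finset.range q, a k * u q L (n+1) ^ k ∈ M q K L (n+1) := by
  apply sum_mem
  intro k hk
  rw [Finset.mem_range] at hk
  refine ⟨mul_mem (A_mono (Nat.le_succ n) (ha k hk).1) (pow_mem (u_mem n) k), fun x hx => ?_⟩
  have hak := (ha k hk).2 x hx
  simp only [Pi.mul_apply, Pi.pow_apply]
  rcases loc K hx n with h | ⟨ρ, hρ, hu, ⟨e, he, hT⟩, hv⟩
  · rw [← mul_assoc, norm_mul, norm_pow]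
    exact mul_lt_one_of_nonneg_of_lt_one_left (norm_nonneg _) hak (pow_le_one₀ (norm_nonneg _) h)
  · rcases hv (a k) (ha k hk).1 with h0 | ⟨j, hj⟩
    · simp [h0]
    · have hρ0 : ρ ≠ 0 := by positivity
      rw [norm_mul, hT, hj, ← zpow_add₀ hρ0] at hak
      rw [norm_mul, norm_mul, norm_pow, hu, hT, hj, ← zpow_natCast, ← zpow_add₀ hρ0, ← zpow_add₀ hρ0]
      have h1 : -((q:ℤ) * e) + q * j < 0 := by
        by_contra hc
        push Not at hc
        exact absurd hak (not_lt.2 (one_le_zpow₀ hρ.le hc))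
      have h2 : j - e < 0 := by
        by_contra hc
        push Not at hc
        have : (0:ℤ) ≤ q * (j - e) := mul_nonneg (by positivity) hc
        linarith
      apply zpow_lt_one_of_neg₀ hρ
      have : (q:ℤ) * (j - e + 1) ≤ 0 := mul_nonpos_of_nonneg_of_nonpos (by positivity) (by omega)
      have hk' : (k:ℤ) < q := by exact_mod_cast hk
      linarith

open Polynomial in
/-- Decomposition, hard direction. -/
theorem coeff_of_M {n : ℕ} {a : ℕ → S q L → L} (ha : ∀ k, a k ∈ A q K L n)
    (hf : ∑ k ∈ Finset.range q, a k * u q L (n+1) ^ k ∈ M q K L (n+1)) {k : ℕ} (hk : k < q) :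
    a k ∈ M q K L n := by
  classical
  refine ⟨ha k, fun x hx => ?_⟩
  rcases loc K hx n with h | ⟨ρ, hρ, hu, -, hv⟩
  · set p : L[X] := ∑ k ∈ Finset.range q, C (T q (x.1 0) * a k x) * Polynomial.X ^ k with hp
    have hpc : p.coeff k = T q (x.1 0) * a k x := by
      rw [hp, finsetSum_coeff, Finset.sum_eq_single k]
      · rw [coeff_C_mul, coeff_X_pow, if_pos rfl, mul_one]
      · intro b _ hb
        rw [coeff_C_mul, coeff_X_pow, if_neg (Ne.symm hb), mul_zero]
      · intro h; exact absurd (Finset.mem_range.2 hk) h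
    rw [← hpc]
    have hinj : Function.Injective (fun β : K => u q L (n+1) x + algebraMap K L β) :=
      fun b c hbc => (algebraMap K L).injective (add_left_cancel hbc)
    apply small_coeff ((Fq q K).image (fun β => u q L (n+1) x + algebraMap K L β))
    · intro y hy
      obtain ⟨β, -, rfl⟩ := Finset.mem_image.1 hy
      exact norm_add_le_of h (norm_K_le β)
    · intro y hy z hz hyz
      obtain ⟨β, -, rfl⟩ := Finset.mem_image.1 hy
      obtain ⟨γ, -, rfl⟩ := Finset.mem_image.1 hz
      rw [add_sub_add_left_eq_sub, ← map_sub]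
      apply norm_K
      intro h0
      rw [sub_eq_zero] at h0
      exact hyz (by rw [h0])
    · rw [Finset.card_image_of_injective _ hinj, card_Fq, hp]
      refine (degree_sum_le _ _).trans_lt ?_
      rw [Finset.sup_lt_iff (WithBot.bot_lt_coe _)]
      intro j hj
      exact (degree_C_mul_X_pow_le _ _).trans_lt (by exact_mod_cast Finset.mem_range.1 hj)
    · intro y hy
      obtain ⟨β, hβ, rfl⟩ := Finset.mem_image.1 hy
      have h1 := hf.2 (mv n x β) (by rwa [mv_le n x β (Nat.zero_le _)])
      rw [mv_le n x β (Nat.zero_le _), usum_apply, u_mv n x hβ, Finset.mul_sum] at h1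
      rw [hp, eval_finsetSum]
      convert h1 using 3
      next j hj =>
        rw [A_mv (ha j)]
        simp [mul_assoc]
  · have h1 := hf.2 x hx
    rw [usum_apply, norm_mul] at h1
    have h2 := (sum_digits (q := q) (by positivity) hρ.ne' hu (fun k => a k x) (fun k _ => hv _ (ha k))).1 k hk
    rw [norm_mul]
    refine (mul_le_mul_of_nonneg_left (le_trans ?_ h2) (norm_nonneg _)).trans_lt h1
    rw [norm_mul, norm_pow, hu]
    exact le_mul_of_one_le_right (norm_nonneg _) (one_le_pow₀ hρ.le)

theorem exists_coeff_M {n : ℕ} {f : S q L → L} (hf : f ∈ M q K L (n+1)) :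
    ∃ a : ℕ → S q L → L, (∀ k, a k ∈ M q K L n) ∧ f = ∑ k ∈ Finset.range q, a k * u q L (n+1) ^ k := by
  obtain ⟨a, ha, rfl⟩ := expand_u hf.1
  refine ⟨fun k => if k < q then a k else 0, fun k => ?_, ?_⟩
  · dsimp only
    split_ifs with hk
    · exact coeff_of_M ha hf hk
    · exact zero_mem _
  · refine Finset.sum_congr rfl fun k hk => ?_
    dsimp only
    rw [if_pos (Finset.mem_range.1 hk)]

variable (q L) in
/-- Polynomial functions of `X_0`. -/
noncomputable def pf (p : Polynomial K) : S q L → L := fun x => Polynomial.aeval (x.1 0) p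

theorem pf_mem (n : ℕ) (p : Polynomial K) : pf q L p ∈ A q K L n := by
  have : pf q L p = Polynomial.aeval (X q L 0) p := by
    funext x
    rw [pf, Polynomial.aeval_eq_sum_range, Polynomial.aeval_eq_sum_range, Finset.sum_apply]
    rfl
  rw [this]
  rw [Polynomial.aeval_eq_sum_range]
  exact sum_mem fun i _ => Subalgebra.smul_mem _ (pow_mem (X_mem (Nat.zero_le _)) i) _

theorem norm_aeval_le {y : L} (hy : ‖y‖ ≤ 1) (p : Polynomial K) : ‖Polynomial.aeval y p‖ ≤ 1 := by
  rw [Polynomial.aeval_eq_sum_range]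
  apply norm_sum_le_one
  intro i _
  rw [Algebra.smul_def, norm_mul, norm_pow]
  exact mul_le_one₀ (norm_K_le _) (by positivity) (pow_le_one₀ (norm_nonneg _) hy)

theorem pf_M (p : Polynomial K) : pf q L p ∈ M q K L 0 := by
  refine ⟨pf_mem 0 p, fun x hx => ?_⟩
  rw [norm_mul]
  exact mul_lt_one_of_nonneg_of_lt_one_left (norm_nonneg _) hx
    (norm_aeval_le (norm_le_of_T (q := q) hx.le) p)

theorem A0_form {f : S q L → L} (hf : f ∈ A q K L 0) :
    ∃ (p : Polynomial K) (k : ℕ), f = pf q L p * invT0 q L ^ k := by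
  have hT : ∀ k : ℕ, pf q L ((Polynomial.X ^ q + Polynomial.X : Polynomial K) ^ k) * invT0 q L ^ k = 1 := by
    intro k
    funext x
    simp only [pf, invT0, Pi.mul_apply, Pi.pow_apply, map_pow, map_add, Polynomial.aeval_X, Pi.one_apply]
    rw [← mul_pow]
    change (T q (x.1 0) * _) ^ k = 1
    rw [mul_inv_cancel₀ (x.T_ne 0), one_pow]
  have hm : ∀ a b : Polynomial K, pf q L (a * b) = pf q L a * pf q L b := by
    intro a b; funext x; simp [pf]
  have ha : ∀ a b : Polynomial K, pf q L (a + b) = pf q L a + pf q L b := by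
    intro a b; funext x; simp [pf]
  induction hf using Algebra.adjoin_induction with
  | mem f hf =>
    rcases hf with rfl | ⟨i, hi, rfl⟩
    · exact ⟨1, 1, by funext x; simp [pf]⟩
    · obtain rfl : i = 0 := by omega
      exact ⟨Polynomial.X, 0, by funext x; simp [pf, X]⟩
  | algebraMap r => exact ⟨Polynomial.C r, 0, by funext x; simp [pf]⟩
  | add f g _ _ hf hg =>
    obtain ⟨p, k, rfl⟩ := hf
    obtain ⟨p', k', rfl⟩ := hg
    refine ⟨p * (Polynomial.X ^ q + Polynomial.X) ^ k' + p' * (Polynomial.X ^ q + Polynomial.X) ^ k, k + k', ?_⟩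
    rw [ha, hm, hm, pow_add]
    have h1 := hT k
    have h2 := hT k'
    linear_combination -(pf q L p * invT0 q L ^ k) * h2 - (pf q L p' * invT0 q L ^ k') * h1
  | mul f g _ _ hf hg =>
    obtain ⟨p, k, rfl⟩ := hf
    obtain ⟨p', k', rfl⟩ := hg
    exact ⟨p * p', k + k', by rw [hm, pow_add]; ring⟩

variable (L) in
/-- The normed field has a nontrivial small element. -/
class NT (L : Type) [NormedField L] : Prop where
  ex : ∃ s : L, s ≠ 0 ∧ ‖s‖ < 1

open Polynomial in
theorem T_poly_prod : (Polynomial.X ^ q + Polynomial.X : K[X]) = ∏ ω ∈ Fq q K, (Polynomial.X - C ω) := by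
  obtain ⟨hd, hm⟩ := natDegree_Tpoly (0 : K) (q := q) (by have := q_ge q; omega)
  rw [C_0, add_zero] at hd hm
  have hr : (Fq q K).val ≤ (Polynomial.X ^ q + Polynomial.X : K[X]).roots := by
    rw [Multiset.le_iff_subset (Fq q K).nodup]
    intro ω hω
    rw [mem_roots hm.ne_zero]
    simpa [T] using T_eq_zero_iff.2 (Finset.mem_def.2 hω)
  have hr2 : (Fq q K).val = (Polynomial.X ^ q + Polynomial.X : K[X]).roots := by
    apply Multiset.eq_of_le_of_card_le hr
    refine (card_roots' _).trans ?_
    rw [hd]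
    exact (card_Fq (q := q) (K := K)).ge
  have := prod_multiset_X_sub_C_of_monic_of_roots_card_eq hm (by rw [← hr2, hd]; exact card_Fq)
  rw [← this, ← hr2]
  rfl

open Polynomial in
theorem M0_form [hNT : NT L] {f : S q L → L} (hf : f ∈ M q K L 0) : ∃ p : K[X], f = pf q L p := by
  obtain ⟨p, k, rfl⟩ := A0_form hf.1
  induction k generalizing p with
  | zero => exact ⟨p, by simp⟩
  | succ k ih =>
    obtain ⟨s, hs0, hs1⟩ := hNT.ex
    have hdvd : (Polynomial.X ^ q + Polynomial.X : K[X]) ∣ p := by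
      rw [T_poly_prod]
      apply Finset.prod_dvd_of_coprime
      · intro a _ b _ hab
        exact isCoprime_X_sub_C_of_isUnit_sub (sub_ne_zero.2 hab).isUnit
      · intro ω hω
        rw [dvd_iff_isRoot, IsRoot]
        by_contra hne
        have hT : T q (algebraMap K L ω + s) = T q s := by rw [add_comm, T_add_Fq hω]
        have hT2 := norm_T_small (q := q) hs1
        have hsp : 0 < ‖s‖ := norm_pos_iff.2 hs0
        obtain ⟨x, hx⟩ := S.exists_start (q := q) (algebraMap K L ω + s) (by
          rw [hT, ← norm_pos_iff, hT2]; exact hsp)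
        have h2 := hf.2 x (by rw [hx, hT, hT2]; exact hs1)
        have h3 : T q (x.1 0) * (pf q L p * invT0 q L ^ (k+1)) x = pf q L p x * invT0 q L x ^ k := by
          have := mul_inv_cancel₀ (x.T_ne 0)
          simp only [Pi.mul_apply, Pi.pow_apply, pow_succ]
          rw [invT0]
          linear_combination (pf q L p x * (T q (x.1 0))⁻¹ ^ k) * this
        rw [h3, norm_mul, norm_pow, invT0, norm_inv, hx, hT, hT2] at h2
        have h4 : 1 ≤ ‖s‖⁻¹ ^ k := one_le_pow₀ ((one_le_inv₀ hsp).2 hs1.le)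
        have h5 : ‖pf q L p x‖ < 1 := (le_mul_of_one_le_right (norm_nonneg _) h4).trans_lt h2
        obtain ⟨g, hg⟩ := X_sub_C_dvd_sub_C_eval (a := ω) (p := p)
        have h6 : pf q L p x = s * aeval (x.1 0) g + algebraMap K L (p.eval ω) := by
          have := congrArg (aeval (x.1 0)) hg
          simp only [map_sub, map_mul, aeval_X, aeval_C] at this
          rw [hx] at this
          rw [pf, hx]
          linear_combination this
        have h7 : ‖s * aeval (x.1 0) g‖ < 1 := by
          rw [norm_mul]
          refine mul_lt_one_of_nonneg_of_lt_one_left (norm_nonneg _) hs1 (norm_aeval_le ?_ g)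
          rw [hx]
          exact norm_add_le_of (norm_K_le ω) hs1.le
        rw [h6, norm_add_right] at h5
        · rw [norm_K hne] at h5; exact lt_irrefl _ h5
        · rw [norm_K hne]; exact h7
    obtain ⟨p', rfl⟩ := hdvd
    have h8 : pf q L ((Polynomial.X ^ q + Polynomial.X) * p') * invT0 q L ^ (k+1) = pf q L p' * invT0 q L ^ k := by
      funext x
      have := mul_inv_cancel₀ (x.T_ne 0)
      simp only [pf, Pi.mul_apply, Pi.pow_apply, map_mul, map_add, map_pow, aeval_X, pow_succ, invT0]
      change T q (x.1 0) * _ * _ = _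
      linear_combination (aeval (x.1 0) p' * (T q (x.1 0))⁻¹ ^ k) * this
    rw [h8] at hf ⊢
    exact ih p' hf

/-- Every function is in `M` after multiplication by a power of `T(X_0)`. -/
theorem exists_pow_M {n : ℕ} {f : S q L → L} (hf : f ∈ A q K L n) : ∃ k, T0 q L ^ k * f ∈ M q K L n := by
  induction n generalizing f with
  | zero =>
    obtain ⟨p, k, rfl⟩ := A0_form hf
    refine ⟨k, ?_⟩
    have h := pf_M (q := q) (L := L) p
    have : T0 q L * invT0 q L = 1 := by
      funext x; exact mul_inv_cancel₀ (x.T_ne 0)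
    rw [mul_left_comm, ← mul_pow, this, one_pow, mul_one]
    exact h
  | succ n ih =>
    obtain ⟨a, ha, rfl⟩ := expand_u hf
    choose N hN using fun k => ih (ha k)
    refine ⟨∑ k ∈ Finset.range q, N k, ?_⟩
    rw [Finset.mul_sum]
    simp_rw [← mul_assoc]
    apply M_of_coeff (a := fun k => T0 q L ^ (∑ k ∈ Finset.range q, N k) * a k)
    intro k hk
    have h1 : N k ≤ ∑ k ∈ Finset.range q, N k :=
      Finset.single_le_sum (fun _ _ => Nat.zero_le _) (Finset.mem_range.2 hk)
    rw [← Nat.sub_add_cancel h1, pow_add, mul_assoc]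
    exact T0_pow_M (hN k) _

end MM
end GSC



namespace GSC
set_option linter.unusedSectionVars false
set_option linter.unusedSimpArgs false

section Inf
variable {q : ℕ} [hQ : QP q] {K L : Type} [Field K] [Fintype K] [CharP K 2] [hGS : GS q K]
  [NormedField L] [IsUltrametricDist L] [IsAlgClosed L] [CharP L 2] [Algebra K L] [hNT : NT L]

theorem norm_sum_lt_of {ι : Type} (s : Finset ι) (g : ι → L) {r : ℝ} (hr : 0 < r) (h : ∀ i ∈ s, ‖g i‖ < r) :
    ‖∑ i ∈ s, g i‖ < r := by
  classical
  induction s using Finset.induction_on with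
  | empty => simpa using hr
  | insert a s ha ih =>
    rw [Finset.sum_insert ha]
    exact norm_add_lt_of (h a (Finset.mem_insert_self _ _)) (ih fun i hi => h i (Finset.mem_insert_of_mem hi))

/-- Principal units. -/
def U1 (w : L) : Prop := ‖w - 1‖ < 1

theorem U1.norm {w : L} (h : U1 w) : ‖w‖ = 1 := by
  have : w = (w - 1) + 1 := by ring
  rw [this, norm_add_right (by rwa [norm_one]), norm_one]

theorem U1.ne {w : L} (h : U1 w) : w ≠ 0 := by
  rw [← norm_pos_iff, h.norm]; exact one_pos

theorem U1.one : U1 (1 : L) := by simp [U1]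

theorem U1.mul {w v : L} (h : U1 w) (h2 : U1 v) : U1 (w * v) := by
  have : w * v - 1 = w * (v - 1) + (w - 1) := by ring
  rw [U1, this]
  exact norm_add_lt_of (by rw [norm_mul, h.norm, one_mul]; exact h2) h

theorem U1.inv {w : L} (h : U1 w) : U1 w⁻¹ := by
  have : w⁻¹ - 1 = -(w⁻¹ * (w - 1)) := by
    have := inv_mul_cancel₀ h.ne
    linear_combination this
  rw [U1, this, norm_neg, norm_mul, norm_inv, h.norm, inv_one, one_mul]
  exact h

theorem U1.pow {w : L} (h : U1 w) (n : ℕ) : U1 (w ^ n) := by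
  induction n with
  | zero => simpa using U1.one
  | succ n ih => rw [pow_succ]; exact ih.mul h

theorem U1.zpow {w : L} (h : U1 w) (n : ℤ) : U1 (w ^ n) := by
  cases n with
  | ofNat n => simpa using h.pow n
  | negSucc n => rw [zpow_negSucc]; exact (h.pow _).inv

/-- Additive form. -/
theorem U1.of_sub {a b : L} (h : ‖a - b‖ < ‖b‖) : ∃ w, U1 w ∧ a = b * w := by
  have hb : b ≠ 0 := by
    rintro rfl
    simp at h
    exact absurd h (not_lt.2 (norm_nonneg _))
  refine ⟨a * b⁻¹, ?_, by field_simp⟩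
  have : a * b⁻¹ - 1 = (a - b) * b⁻¹ := by field_simp
  rw [U1, this, norm_mul, norm_inv, ← div_eq_mul_inv, div_lt_one (norm_pos_iff.2 hb)]
  exact h

theorem U1.sub_lt {w v : L} (h : U1 w) (h2 : U1 v) : ‖w - v‖ < 1 := by
  have : w - v = (w - 1) + -(v - 1) := by ring
  rw [this]
  exact norm_add_lt_of h (by rw [norm_neg]; exact h2)

variable (q L) in
theorem exists_xinf : ∃ x : S q L, 1 < ‖x.1 0‖ := by
  obtain ⟨s, hs0, hs1⟩ := hNT.ex
  have h1 : 1 < ‖s⁻¹‖ := by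
    rw [norm_inv]; exact (one_lt_inv₀ (norm_pos_iff.2 hs0)).2 hs1
  obtain ⟨x, hx⟩ := S.exists_start (q := q) s⁻¹ (by
    rw [← norm_pos_iff, norm_T_large h1]; positivity)
  exact ⟨x, by rw [hx]; exact h1⟩

variable (q L) in
/-- The chosen point near infinity. -/
noncomputable def xinf : S q L := (exists_xinf q L).choose

variable (q L) in
/-- Its coordinates' norms. -/
noncomputable def Γ (n : ℕ) : ℝ := ‖(xinf q L).1 n‖

theorem one_lt_Γ (n : ℕ) : 1 < Γ q L n := by
  induction n with
  | zero => exact (exists_xinf q L).choose_spec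
  | succ n ih => exact ((xinf q L).step_large ih).1

theorem Γ_pow (n : ℕ) : Γ q L (n+1) ^ q = Γ q L n := ((xinf q L).step_large (one_lt_Γ n)).2

theorem Γ_pos (n : ℕ) : 0 < Γ q L n := one_pos.trans (one_lt_Γ n)

theorem Γ_zpow (n : ℕ) (j : ℤ) : Γ q L n ^ j = Γ q L (n+1) ^ ((q:ℤ) * j) := by
  rw [← Γ_pow n, zpow_mul, zpow_natCast]

theorem xinf_step (n : ℕ) : ∃ w : L, U1 w ∧ (xinf q L).1 n = (xinf q L).1 (n+1) ^ q * w := by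
  set x := xinf q L
  have hn : 1 < ‖x.1 n‖ := one_lt_Γ n
  have hn1 : 1 < ‖x.1 (n+1)‖ := one_lt_Γ (n+1)
  have e : ‖x.1 (n+1)‖ ^ q = ‖x.1 n‖ := Γ_pow n
  apply U1.of_sub
  have h1 := inv_T_large (q := q) hn
  rw [← x.T_succ] at h1
  have h2 : x.1 n - x.1 (n+1) ^ q = (T q (x.1 (n+1)) + x.1 n) + (x.1 (n+1)) - (x.1 (n+1) ^ q + x.1 (n+1) ^ q)
      - (x.1 (n+1) + x.1 (n+1)) := by rw [T]; ring
  rw [h2, ch2, ch2, sub_zero, sub_zero, norm_pow]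
  have h3 : ‖x.1 (n+1)‖ < ‖x.1 (n+1)‖ ^ q := lt_self_pow₀ hn1 (by have := q_ge q; omega)
  refine norm_add_lt_of (h1.trans_lt ?_) h3
  exact hn1.trans h3

open Polynomial in
theorem pf_lead (p : K[X]) (hp : p ≠ 0) : ∃ w : L, U1 w ∧
    pf q L p (xinf q L) = algebraMap K L p.leadingCoeff * (xinf q L).1 0 ^ p.natDegree * w := by
  apply U1.of_sub
  set y := (xinf q L).1 0
  have hy : 1 < ‖y‖ := one_lt_Γ 0
  rw [norm_mul, norm_K (leadingCoeff_ne_zero.2 hp), one_mul, norm_pow, pf, aeval_eq_sum_range, Finset.sum_range_succ,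
    Algebra.smul_def, coeff_natDegree, add_sub_cancel_right]
  apply norm_sum_lt_of _ _ (by positivity)
  intro i hi
  rw [Algebra.smul_def, norm_mul, norm_pow]
  calc _ ≤ ‖y‖ ^ i := mul_le_of_le_one_left (by positivity) (norm_K_le _)
    _ < _ := pow_lt_pow_right₀ hy (Finset.mem_range.1 hi)

theorem T0_lead : ∃ w : L, U1 w ∧ T0 q L (xinf q L) = (xinf q L).1 0 ^ q * w := by
  apply U1.of_sub
  set y := (xinf q L).1 0
  have hy : 1 < ‖y‖ := one_lt_Γ 0
  change ‖y ^ q + y - y ^ q‖ < _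
  rw [add_sub_cancel_left, norm_pow]
  exact lt_self_pow₀ hy (by have := q_ge q; omega)

/-- `X`-expansion at infinity. -/
theorem expand_X {n : ℕ} {f : S q L → L} (hf : f ∈ A q K L (n+1)) :
    ∃ a : ℕ → S q L → L, (∀ k, a k ∈ A q K L n) ∧ f = ∑ k ∈ Finset.range q, a k * X q L (n+1) ^ k := by
  obtain ⟨a, ha, h⟩ := expand (zero_mem (A q K L n)) hf
  exact ⟨a, ha, by simpa using h⟩

theorem Xsum_apply (n : ℕ) (a : ℕ → S q L → L) (x : S q L) :
    (∑ k ∈ Finset.range q, a k * X q L n ^ k) x = ∑ k ∈ Finset.range q, a k x * x.1 n ^ k := by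
  rw [Finset.sum_apply]; rfl

theorem xinf_ne (n : ℕ) : (xinf q L).1 n ≠ 0 := (xinf q L).ne n

/-- Leading term at infinity. -/
theorem inf_lead {n : ℕ} {f : S q L → L} (hf : f ∈ A q K L n) :
    f = 0 ∨ ∃ (c : K) (j : ℤ) (w : L), c ≠ 0 ∧ U1 w ∧
      f (xinf q L) = algebraMap K L c * (xinf q L).1 n ^ j * w := by
  induction n generalizing f with
  | zero =>
    obtain ⟨p, k, rfl⟩ := A0_form hf
    by_cases hp : p = 0
    · left; subst hp; funext x; simp [pf]
    · right
      obtain ⟨w, hw, h1⟩ := pf_lead (q := q) (L := L) p hp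
      obtain ⟨v, hv, h2⟩ := T0_lead (q := q) (L := L)
      refine ⟨p.leadingCoeff, p.natDegree - q * k, w * v⁻¹ ^ k, Polynomial.leadingCoeff_ne_zero.2 hp,
        hw.mul (hv.inv.pow k), ?_⟩
      have h3 : invT0 q L (xinf q L) = ((xinf q L).1 0 ^ q * v)⁻¹ := by
        rw [← h2]; rfl
      rw [Pi.mul_apply, Pi.pow_apply, h1, h3, zpow_sub₀ (xinf_ne 0), zpow_natCast, zpow_mul, zpow_natCast, zpow_natCast]
      rw [mul_inv, mul_pow, inv_pow, div_eq_mul_inv]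
      ring
  | succ n ih =>
    obtain ⟨a, ha, rfl⟩ := expand_X hf
    set x := xinf q L with hx
    have hd : ∀ k < q, a k x = 0 ∨ ∃ j : ℤ, ‖a k x‖ = Γ q L (n+1) ^ ((q:ℤ) * j) := by
      intro k _
      rcases ih (ha k) with h | ⟨c, j, w, hc, hw, h⟩
      · left; rw [h]; rfl
      · right
        refine ⟨j, ?_⟩
        rw [h, norm_mul, norm_mul, norm_K hc, hw.norm, norm_zpow, ← Γ_zpow]
        simp [Γ, hx]
    have hρ := one_lt_Γ (q := q) (L := L) (n+1)
    obtain ⟨h1, h2⟩ := sum_digits (q := q) (Γ_pos (n+1)) hρ.ne' (y := x.1 (n+1)) rfl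
      (fun k => a k x) hd
    rcases h2 with h2 | ⟨k0, hk0, j0, h3, h4, h5⟩
    · left
      apply Finset.sum_eq_zero
      intro k hk
      have h6 := h1 k (Finset.mem_range.1 hk)
      rw [h2, norm_zero] at h6
      have h7 : a k x = 0 := by
        have := norm_le_zero_iff.1 h6
        exact (mul_eq_zero.1 this).resolve_right (pow_ne_zero _ (xinf_ne _))
      rcases ih (ha k) with h | ⟨c, j, w, hc, hw, h⟩
      · rw [h, zero_mul]
      · exfalso
        rw [h7] at h
        have hc' : algebraMap K L c ≠ 0 := by simpa using hc
        exact mul_ne_zero (mul_ne_zero hc' (zpow_ne_zero _ (xinf_ne n))) hw.ne h.symm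
    · right
      have hterm : ‖a k0 x * x.1 (n+1) ^ k0‖ = Γ q L (n+1) ^ ((q:ℤ) * j0 + k0) := by
        rw [norm_mul, h3, norm_pow, zpow_add₀ (Γ_pos _).ne', zpow_natCast]; rfl
      have hU : ∃ w, U1 w ∧ ∑ k ∈ Finset.range q, a k x * x.1 (n+1) ^ k = a k0 x * x.1 (n+1) ^ k0 * w := by
        apply U1.of_sub
        rw [← Finset.add_sum_erase _ _ (Finset.mem_range.2 hk0), add_sub_cancel_left, hterm]
        apply norm_sum_lt_of _ _ (zpow_pos (Γ_pos _) _)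
        intro k hk
        obtain ⟨hkk, hk⟩ := Finset.mem_erase.1 hk
        rw [Finset.mem_range] at hk
        have h6 := h1 k hk
        rw [h5] at h6
        refine lt_of_le_of_ne h6 fun he => ?_
        rcases hd k hk with h7 | ⟨j, h7⟩
        · rw [h7, zero_mul, norm_zero] at he
          exact (zpow_pos (Γ_pos _) _).ne he
        · rw [norm_mul, h7, norm_pow] at he
          change _ * Γ q L (n+1) ^ k = _ at he
          rw [← zpow_natCast, ← zpow_add₀ (Γ_pos _).ne'] at he
          have he := zpow_right_injective₀ (Γ_pos _) hρ.ne' he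
          have h8 := congrArg (fun z : ℤ => z % (q:ℤ)) he
          simp only [Int.mul_add_emod_self_left] at h8
          rw [Int.emod_eq_of_lt (by positivity) (by exact_mod_cast hk),
            Int.emod_eq_of_lt (by positivity) (by exact_mod_cast hk0)] at h8
          exact hkk (by exact_mod_cast h8)
      obtain ⟨w, hw, hw2⟩ := hU
      rw [Xsum_apply, hw2]
      rcases ih (ha k0) with h | ⟨c, j, v, hc, hv, h⟩
      · exact absurd (by rw [h]; rfl) h4
      obtain ⟨t, ht, h9⟩ := xinf_step (q := q) (L := L) n
      refine ⟨c, q * j + k0, t ^ j * v * w, hc, ((ht.zpow j).mul hv).mul hw, ?_⟩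
      rw [h, h9, mul_zpow, zpow_add₀ (xinf_ne _), zpow_mul, zpow_natCast, zpow_natCast]
      ring

/-- Pointwise estimate for the `X`-coefficients at infinity. -/
theorem inf_coeff {n : ℕ} {a : ℕ → S q L → L} (ha : ∀ k, a k ∈ A q K L n) {k : ℕ} (hk : k < q) :
    ‖a k (xinf q L)‖ * Γ q L (n+1) ^ k ≤ ‖(∑ k ∈ Finset.range q, a k * X q L (n+1) ^ k) (xinf q L)‖ := by
  have hd : ∀ k < q, a k (xinf q L) = 0 ∨ ∃ j : ℤ, ‖a k (xinf q L)‖ = Γ q L (n+1) ^ ((q:ℤ) * j) := by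
    intro k _
    rcases inf_lead (ha k) with h | ⟨c, j, w, hc, hw, h⟩
    · left; rw [h]; rfl
    · right
      refine ⟨j, ?_⟩
      rw [h, norm_mul, norm_mul, norm_K hc, hw.norm, norm_zpow, ← Γ_zpow]
      simp [Γ]
  have := (sum_digits (q := q) (Γ_pos (n+1)) (one_lt_Γ (n+1)).ne' (y := (xinf q L).1 (n+1)) rfl
      (fun k => a k (xinf q L)) hd).1 k hk
  rw [Xsum_apply]
  rw [norm_mul, norm_pow] at this
  exact this

theorem inf_norm {n : ℕ} {f : S q L → L} (hf : f ∈ A q K L n) (h0 : f ≠ 0) :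
    ∃ j : ℤ, ‖f (xinf q L)‖ = Γ q L n ^ j := by
  rcases inf_lead hf with h | ⟨c, j, w, hc, hw, h⟩
  · exact absurd h h0
  · exact ⟨j, by rw [h, norm_mul, norm_mul, norm_K hc, hw.norm, norm_zpow]; simp [Γ]⟩

theorem inf_small {n : ℕ} {f : S q L → L} (hf : f ∈ A q K L n) (h1 : ‖f (xinf q L)‖ < 1) :
    ‖f (xinf q L)‖ ≤ (Γ q L n)⁻¹ := by
  by_cases h0 : f = 0
  · rw [h0]; simp [(Γ_pos (q := q) (L := L) n).le]
  obtain ⟨j, hj⟩ := inf_norm hf h0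
  rw [hj] at h1 ⊢
  have : j < 0 := by
    by_contra hc
    push Not at hc
    exact absurd h1 (not_lt.2 (one_le_zpow₀ (one_lt_Γ n).le hc))
  rw [← zpow_neg_one]
  exact zpow_le_zpow_right₀ (one_lt_Γ n).le (by omega)

variable (q K L) in
/-- `A = M + P`, membership predicate. -/
def MP (n : ℕ) (f : S q L → L) : Prop :=
  ∃ m ∈ M q K L n, ∃ p ∈ A q K L n, ‖p (xinf q L)‖ < 1 ∧ f = m + p

theorem MP.add {n : ℕ} {f g : S q L → L} (hf : MP q K L n f) (hg : MP q K L n g) : MP q K L n (f + g) := by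
  obtain ⟨m, hm, p, hp, h1, rfl⟩ := hf
  obtain ⟨m', hm', p', hp', h1', rfl⟩ := hg
  exact ⟨m + m', add_mem hm hm', p + p', add_mem hp hp', norm_add_lt_of h1 h1', by ring⟩

theorem MP.sum {n : ℕ} {ι : Type} (s : Finset ι) (g : ι → S q L → L) (h : ∀ i ∈ s, MP q K L n (g i)) :
    MP q K L n (∑ i ∈ s, g i) := by
  classical
  induction s using Finset.induction_on with
  | empty => exact ⟨0, zero_mem _, 0, zero_mem _, by simp, by simp⟩
  | insert a s ha ih =>
    rw [Finset.sum_insert ha]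
    exact (h a (Finset.mem_insert_self _ _)).add (ih fun i hi => h i (Finset.mem_insert_of_mem hi))

theorem MP.of_M {n : ℕ} {f : S q L → L} (hf : f ∈ M q K L n) : MP q K L n f :=
  ⟨f, hf, 0, zero_mem _, by simp, by simp⟩

theorem MP.of_P {n : ℕ} {f : S q L → L} (hf : f ∈ A q K L n) (h : ‖f (xinf q L)‖ < 1) : MP q K L n f :=
  ⟨0, zero_mem _, f, hf, h, by simp⟩

theorem M_mul_u {n : ℕ} {m : S q L → L} (hm : m ∈ M q K L n) {k : ℕ} (hk : k < q) :
    m * u q L (n+1) ^ k ∈ M q K L (n+1) := by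
  have := M_of_coeff (q := q) (K := K) (L := L) (n := n) (a := fun i => if i = k then m else 0)
    (by intro i _; split_ifs; exacts [hm, zero_mem _])
  rw [Finset.sum_eq_single k] at this
  · simpa using this
  · intro b _ hb; simp [hb]
  · intro h; exact absurd (Finset.mem_range.2 hk) h

open Polynomial in
theorem A_MP {n : ℕ} {f : S q L → L} (hf : f ∈ A q K L n) : MP q K L n f := by
  induction n generalizing f with
  | zero =>
    obtain ⟨p, k, rfl⟩ := A0_form hf
    set t : K[X] := (Polynomial.X ^ q + Polynomial.X) ^ k with ht
    have htm : t.Monic ∧ t.natDegree = q * k := by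
      obtain ⟨hd, hm⟩ := natDegree_Tpoly (0 : K) (q := q) (by have := q_ge q; omega)
      rw [C_0, add_zero] at hd hm
      exact ⟨hm.pow k, by rw [ht, hm.natDegree_pow, hd, mul_comm]⟩
    have hTi : pf q L t * invT0 q L ^ k = 1 := by
      funext x
      simp only [ht, pf, invT0, Pi.mul_apply, Pi.pow_apply, map_pow, map_add, Polynomial.aeval_X, Pi.one_apply]
      rw [← mul_pow]
      change (T q (x.1 0) * _) ^ k = 1
      rw [mul_inv_cancel₀ (x.T_ne 0), one_pow]
    have hp : pf q L p = pf q L (p %ₘ t) + pf q L t * pf q L (p /ₘ t) := by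
      conv_lhs => rw [← modByMonic_add_div p t]
      funext x; simp [pf]
    refine ⟨pf q L (p /ₘ t), pf_M _, pf q L (p %ₘ t) * invT0 q L ^ k,
      mul_mem (pf_mem 0 _) (pow_mem (invT0_mem 0) k), ?_, ?_⟩
    · by_cases h0 : p %ₘ t = 0
      · rw [h0]; simp [pf]
      · obtain ⟨w, hw, h1⟩ := pf_lead (q := q) (L := L) _ h0
        obtain ⟨v, hv, h2⟩ := T0_lead (q := q) (L := L)
        have h3 : invT0 q L (xinf q L) = ((xinf q L).1 0 ^ q * v)⁻¹ := by
          rw [← h2]; rfl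
        have hlt : (p %ₘ t).natDegree < q * k := by
          rw [← htm.2]
          apply natDegree_modByMonic_lt _ htm.1
          intro h1
          rw [h1, modByMonic_one] at h0
          exact h0 rfl
        rw [Pi.mul_apply, Pi.pow_apply, h1, h3]
        simp only [norm_mul, norm_inv, norm_pow, hw.norm, hv.norm, norm_K (leadingCoeff_ne_zero.2 h0),
          one_mul, mul_one, inv_pow, ← pow_mul]
        rw [← div_eq_mul_inv, div_lt_one (by exact pow_pos (Γ_pos (q := q) (L := L) 0) _)]
        exact pow_lt_pow_right₀ (one_lt_Γ (q := q) (L := L) 0) hlt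
    · rw [hp]
      linear_combination (pf q L (p /ₘ t)) * hTi
  | succ n ih =>
    have key : ∀ k < q, ∀ a ∈ A q K L n, MP q K L (n+1) (a * X q L (n+1) ^ k) := by
      intro k
      induction k using Nat.strong_induction_on with
      | _ k ihk =>
        intro hk a ha
        obtain ⟨m, hm, p, hp, hp1, rfl⟩ := ih ha
        rw [add_mul]
        refine MP.add ?_ (MP.of_P (mul_mem (A_mono (Nat.le_succ n) hp) (pow_mem (X_mem le_rfl) k)) ?_)
        · have h1 : m * X q L (n+1) ^ k = m * u q L (n+1) ^ k +
              ∑ l ∈ Finset.range k, (-(m * cc q L (n+1) ^ (k - l) * (k.choose l : S q L → L))) * X q L (n+1) ^ l := by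
            rw [u, add_pow, Finset.sum_range_succ, mul_add, Finset.mul_sum]
            simp only [Nat.choose_self, Nat.sub_self, pow_zero, Nat.cast_one, mul_one]
            have : ∀ a b c : S q L → L, a + b + c = b + (a + c) := fun a b c => by ring
            rw [this, ← Finset.sum_add_distrib]
            rw [Finset.sum_eq_zero, add_zero]
            intro l _
            ring
          rw [h1]
          refine (MP.of_M (M_mul_u hm hk)).add (MP.sum _ _ fun l hl => ?_)
          rw [Finset.mem_range] at hl
          refine ihk l hl (hl.trans hk) _ (neg_mem (mul_mem (mul_mem hm.1 (pow_mem (cc_mem n) _)) ?_))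
          exact natCast_mem _ _
        · rw [Pi.mul_apply, norm_mul, Pi.pow_apply, norm_pow]
          change _ * Γ q L (n+1) ^ k < 1
          have h2 := inf_small hp hp1
          calc _ ≤ (Γ q L n)⁻¹ * Γ q L (n+1) ^ k := mul_le_mul_of_nonneg_right h2 (pow_nonneg (Γ_pos _).le _)
            _ < 1 := by
              rw [mul_comm, ← div_eq_mul_inv, div_lt_one (Γ_pos n), ← Γ_pow n]
              exact pow_lt_pow_right₀ (one_lt_Γ _) hk
    obtain ⟨a, ha, rfl⟩ := expand_X hf
    exact MP.sum _ _ fun k hk => key k (Finset.mem_range.1 hk) _ (ha k)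

/-- Nonzero elements of `M` are not small at infinity. -/
theorem M_large {n : ℕ} {f : S q L → L} (hf : f ∈ M q K L n) (h0 : f ≠ 0) : 1 ≤ ‖f (xinf q L)‖ := by
  classical
  induction n generalizing f with
  | zero =>
    obtain ⟨p, rfl⟩ := M0_form hf
    have hp : p ≠ 0 := by rintro rfl; apply h0; funext x; simp [pf]
    obtain ⟨w, hw, h1⟩ := pf_lead (q := q) (L := L) p hp
    rw [h1, norm_mul, norm_mul, norm_K (Polynomial.leadingCoeff_ne_zero.2 hp), hw.norm, one_mul, mul_one, norm_pow]
    exact one_le_pow₀ (one_lt_Γ (q := q) (L := L) 0).le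
  | succ n ih =>
    obtain ⟨a, ha, rfl⟩ := exists_coeff_M hf
    have hex : ∃ k ∈ Finset.range q, a k ≠ 0 := by
      by_contra hc
      push Not at hc
      exact h0 (Finset.sum_eq_zero fun k hk => by rw [hc k hk, zero_mul])
    set s := (Finset.range q).filter (fun k => a k ≠ 0) with hs
    have hsn : s.Nonempty := by
      obtain ⟨k, hk, hk'⟩ := hex
      exact ⟨k, Finset.mem_filter.2 ⟨hk, hk'⟩⟩
    set k0 := s.max' hsn with hk0
    obtain ⟨hk1, hk2⟩ := Finset.mem_filter.1 (s.max'_mem hsn)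
    rw [← hk0] at hk1 hk2
    have hmax : ∀ k < q, k0 < k → a k = 0 := by
      intro k hk hlt
      by_contra hne
      exact absurd (s.le_max' k (Finset.mem_filter.2 ⟨Finset.mem_range.2 hk, hne⟩)) (not_le.2 hlt)
    set b : ℕ → S q L → L := fun l => ∑ k ∈ Finset.range q,
      if l ≤ k then a k * cc q L (n+1) ^ (k - l) * (k.choose l : S q L → L) else 0 with hb
    have hbA : ∀ l, b l ∈ A q K L n := by
      intro l
      apply sum_mem
      intro k _
      split_ifs
      · exact mul_mem (mul_mem (ha k).1 (pow_mem (cc_mem n) _)) (natCast_mem _ _)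
      · exact zero_mem _
    have hsum : ∑ k ∈ Finset.range q, a k * u q L (n+1) ^ k = ∑ l ∈ Finset.range q, b l * X q L (n+1) ^ l := by
      simp only [hb, Finset.sum_mul]
      rw [Finset.sum_comm]
      refine Finset.sum_congr rfl fun k hk => ?_
      rw [Finset.mem_range] at hk
      rw [u, add_pow, Finset.mul_sum]
      rw [← Finset.sum_subset (Finset.range_subset_range.2 (Nat.succ_le_of_lt hk))]
      · refine Finset.sum_congr rfl fun l hl => ?_
        rw [Finset.mem_range] at hl
        rw [if_pos (by omega)]
        ring
      · intro l _ hl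
        rw [Finset.mem_range] at hl
        rw [if_neg (by omega), zero_mul]
    have hbk : b k0 = a k0 := by
      simp only [hb]
      rw [Finset.sum_eq_single k0]
      · simp
      · intro k hk hne
        rw [Finset.mem_range] at hk
        split_ifs with hle
        · rw [hmax k hk (lt_of_le_of_ne hle (Ne.symm hne))]; simp
        · rfl
      · intro h; exact absurd hk1 h
    rw [hsum]
    refine le_trans ?_ (inf_coeff hbA (Finset.mem_range.1 hk1))
    rw [hbk]
    exact one_le_mul_of_one_le_of_one_le (ih (ha k0) hk2) (one_le_pow₀ (one_lt_Γ _).le)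

theorem exists_F (n i : ℕ) : ∃ f ∈ M q K L n, ∃ w : L, U1 w ∧ f (xinf q L) = (xinf q L).1 n ^ i * w := by
  obtain ⟨m, hm, p, hp, hp1, h⟩ := A_MP (K := K) (pow_mem (X_mem (q := q) (L := L) (K := K) (le_refl n)) i)
  refine ⟨m, hm, U1.of_sub ?_⟩
  have h1 := congrFun h (xinf q L)
  change (xinf q L).1 n ^ i = m _ + p _ at h1
  rw [h1, sub_add_cancel_left, norm_neg, ← h1, norm_pow]
  exact hp1.trans_le (one_le_pow₀ (one_lt_Γ (q := q) (L := L) n).le)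

variable (q K L) in
/-- Basis of `M n` by pole order at infinity. -/
noncomputable def F (n i : ℕ) : S q L → L := (exists_F (q := q) (K := K) (L := L) n i).choose

theorem F_mem (n i : ℕ) : F q K L n i ∈ M q K L n := (exists_F n i).choose_spec.1

theorem F_lead (n i : ℕ) : ∃ w : L, U1 w ∧ F q K L n i (xinf q L) = (xinf q L).1 n ^ i * w :=
  (exists_F n i).choose_spec.2

theorem F_norm (n i : ℕ) : ‖F q K L n i (xinf q L)‖ = Γ q L n ^ i := by
  obtain ⟨w, hw, h⟩ := F_lead (q := q) (K := K) (L := L) n i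
  rw [h, norm_mul, hw.norm, mul_one, norm_pow]; rfl

theorem M_lead {n : ℕ} {f : S q L → L} (hf : f ∈ M q K L n) (h0 : f ≠ 0) :
    ∃ (s : ℕ) (c : K) (g : S q L → L), c ≠ 0 ∧ g ∈ M q K L n ∧ f = c • F q K L n s + g ∧
      ‖f (xinf q L)‖ = Γ q L n ^ s ∧ ‖g (xinf q L)‖ < Γ q L n ^ s := by
  rcases inf_lead hf.1 with h | ⟨c, j, w, hc, hw, h⟩
  · exact absurd h h0
  have hnorm : ‖f (xinf q L)‖ = Γ q L n ^ j := by
    rw [h, norm_mul, norm_mul, norm_K hc, hw.norm, norm_zpow]; simp [Γ]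
  have hj : 0 ≤ j := by
    by_contra hneg
    push Not at hneg
    have := M_large hf h0
    rw [hnorm] at this
    exact absurd (zpow_lt_one_of_neg₀ (one_lt_Γ n) hneg) (not_lt.2 this)
  lift j to ℕ using hj
  rw [zpow_natCast] at h hnorm
  refine ⟨j, c, f - c • F q K L n j, hc, sub_mem hf (Submodule.smul_mem _ _ (F_mem n j)), by ring, hnorm, ?_⟩
  obtain ⟨v, hv, h2⟩ := F_lead (q := q) (K := K) (L := L) n j
  rw [Pi.sub_apply, Pi.smul_apply, h, h2, Algebra.smul_def]
  have : algebraMap K L c * (xinf q L).1 n ^ j * w - algebraMap K L c * ((xinf q L).1 n ^ j * v)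
    = algebraMap K L c * (xinf q L).1 n ^ j * (w - v) := by ring
  rw [this, norm_mul, norm_mul, norm_K hc, one_mul, norm_pow]
  exact mul_lt_of_lt_one_right (pow_pos (Γ_pos (q := q) (L := L) n) _) (hw.sub_lt hv)

theorem M_span {n : ℕ} (s : ℕ) {f : S q L → L} (hf : f ∈ M q K L n) (h : ‖f (xinf q L)‖ < Γ q L n ^ s) :
    f ∈ Submodule.span K (F q K L n '' Set.Iio s) := by
  induction s generalizing f with
  | zero =>
    by_cases h0 : f = 0
    · rw [h0]; exact zero_mem _
    · rw [pow_zero] at h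
      exact absurd h (not_lt.2 (M_large hf h0))
  | succ s ih =>
    by_cases h0 : f = 0
    · rw [h0]; exact zero_mem _
    obtain ⟨t, c, g, -, hg, rfl, h1, h2⟩ := M_lead hf h0
    rw [h1] at h
    have ht : t < s + 1 := (pow_lt_pow_iff_right₀ (one_lt_Γ n)).1 h
    refine add_mem (Submodule.smul_mem _ _ (Submodule.subset_span ⟨t, ht, rfl⟩)) ?_
    have h3 := ih hg (h2.trans_le (pow_le_pow_right₀ (one_lt_Γ n).le (by omega)))
    exact Submodule.span_mono (Set.image_mono (Set.Iio_subset_Iio (Nat.le_succ s))) h3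

theorem T0_norm (n : ℕ) : ‖T0 q L (xinf q L)‖ = Γ q L n ^ (q * q ^ n) := by
  have h0 : ∀ n, Γ q L 0 = Γ q L n ^ (q ^ n) := by
    intro n
    induction n with
    | zero => simp
    | succ n ih => rw [ih, ← Γ_pow n, ← pow_mul, pow_succ, mul_comm]
  obtain ⟨w, hw, h⟩ := T0_lead (q := q) (L := L)
  rw [h, norm_mul, hw.norm, mul_one, norm_pow]
  change Γ q L 0 ^ q = _
  rw [h0 n, ← pow_mul, mul_comm]

end Inf
end GSC



namespace GSC
set_option linter.unusedSectionVars false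
set_option linter.unusedSimpArgs false

section Tr
variable {q : ℕ} [hQ : QP q] {K L : Type} [Field K] [Fintype K] [CharP K 2] [hGS : GS q K]
  [NormedField L] [IsUltrametricDist L] [IsAlgClosed L] [CharP L 2] [Algebra K L] [hNT : NT L]

open Polynomial in
theorem Fq_weights [DecidableEq K] {β : K} (hβ : β ∈ Fq q K) : ∏ γ ∈ (Fq q K).erase β, (β - γ) = 1 := by
  have h := Lagrange.eval_nodal_derivative_eval_node_eq (s := Fq q K) (v := id) hβ
  have h2 : Lagrange.nodal (Fq q K) id = (Polynomial.X ^ q + Polynomial.X : K[X]) := by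
    rw [T_poly_prod]; rfl
  rw [h2, Lagrange.eval_nodal] at h
  have hq0 : (q : K) = 0 := by
    obtain ⟨m, hm, rfl⟩ := hQ.pow
    have : (2:K) = 0 := CharTwo.two_eq_zero
    push_cast
    rw [this, zero_pow (by omega)]
  simp [hq0, derivative_X_pow] at h
  exact h.symm

open Polynomial in
theorem sum_poly (y : L) (p : L[X]) (hp : p.degree < q) :
    ∑ β ∈ Fq q K, p.eval (y + algebraMap K L β) = p.coeff (q-1) := by
  classical
  have hinj : Set.InjOn (fun β : K => y + algebraMap K L β) (Fq q K) :=
    fun a _ b _ h => (algebraMap K L).injective (add_left_cancel h)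
  have h := Lagrange.coeff_eq_sum hinj (P := p) (by rw [card_Fq]; exact hp)
  rw [card_Fq] at h
  rw [h]
  refine Finset.sum_congr rfl fun β hβ => ?_
  have : ∏ j ∈ (Fq q K).erase β, (y + algebraMap K L β - (y + algebraMap K L j)) = 1 := by
    rw [← map_one (algebraMap K L), ← Fq_weights hβ, map_prod]
    refine Finset.prod_congr rfl fun j _ => ?_
    rw [map_sub]; ring
  rw [this, div_one]

theorem sum_pow_small (y : L) {k : ℕ} (hk : k < q) :
    ∑ β ∈ Fq q K, (y + algebraMap K L β) ^ k = if k = q - 1 then 1 else 0 := by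
  have h := sum_poly (q := q) (K := K) y (Polynomial.X ^ k) (by
    rw [Polynomial.degree_X_pow]; exact_mod_cast hk)
  simp only [Polynomial.eval_pow, Polynomial.eval_X, Polynomial.coeff_X_pow] at h
  rw [h]
  simp only [eq_comm]

theorem sum_pow_large (y : L) {k : ℕ} (hk : k ≤ 2 * q - 2) :
    ∑ β ∈ Fq q K, (y + algebraMap K L β) ^ k = if k = q - 1 ∨ k = 2 * q - 2 then 1 else 0 := by
  have hq := q_ge q
  rcases lt_or_ge k q with h | h
  · rw [sum_pow_small y h]
    congr 1
    simp only [eq_iff_iff]; omega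
  · obtain ⟨j, rfl⟩ := Nat.exists_eq_add_of_le h
    have h1 : ∀ β ∈ Fq q K, (y + algebraMap K L β) ^ (q + j) =
        T q y * (y + algebraMap K L β) ^ j + (y + algebraMap K L β) ^ (j + 1) := by
      intro β hβ
      have h2 : (y + algebraMap K L β) ^ q + (y + algebraMap K L β) = T q y := T_add_Fq hβ y
      have h3 := ch2 (y + algebraMap K L β)
      rw [pow_add]
      linear_combination (y + algebraMap K L β) ^ j * h2 - (y + algebraMap K L β) ^ j * h3
    rw [Finset.sum_congr rfl h1, Finset.sum_add_distrib, ← Finset.mul_sum, sum_pow_small y (by omega),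
      sum_pow_small y (by omega), if_neg (by omega), mul_zero, zero_add]
    congr 1
    simp only [eq_iff_iff]; omega

variable (q K L) in
/-- The trace along the fibre. -/
noncomputable def tr (n : ℕ) : (S q L → L) →ₗ[K] (S q L → L) where
  toFun h := fun x => ∑ β ∈ Fq q K, h (mv n x β)
  map_add' f g := by funext x; simp [Finset.sum_add_distrib]
  map_smul' c f := by funext x; simp [Finset.smul_sum]

theorem tr_apply (n : ℕ) (h : S q L → L) (x : S q L) : tr q K L n h x = ∑ β ∈ Fq q K, h (mv n x β) := rfl

theorem tr_inf {n : ℕ} {h : S q L → L} (hh : h ∈ A q K L (n+1)) :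
    tr q K L n h ∈ A q K L n ∧ ‖tr q K L n h (xinf q L)‖ * Γ q L (n+1) ^ (q-1) ≤ ‖h (xinf q L)‖ := by
  have hq := q_ge q
  obtain ⟨a, ha, rfl⟩ := expand_X hh
  have h1 : tr q K L n (∑ k ∈ Finset.range q, a k * X q L (n+1) ^ k) = a (q-1) := by
    funext x
    rw [tr_apply]
    have h2 : ∀ β ∈ Fq q K, (∑ k ∈ Finset.range q, a k * X q L (n+1) ^ k) (mv n x β)
        = ∑ k ∈ Finset.range q, a k x * (x.1 (n+1) + algebraMap K L β) ^ k := by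
      intro β hβ
      rw [Xsum_apply, mv_succ n x hβ]
      exact Finset.sum_congr rfl fun k _ => by rw [A_mv (ha k)]
    rw [Finset.sum_congr rfl h2, Finset.sum_comm]
    have h3 : ∀ k ∈ Finset.range q, ∑ β ∈ Fq q K, a k x * (x.1 (n+1) + algebraMap K L β) ^ k
        = if k = q - 1 then a k x else 0 := by
      intro k hk
      rw [← Finset.mul_sum, sum_pow_small _ (Finset.mem_range.1 hk)]
      split_ifs <;> simp
    rw [Finset.sum_congr rfl h3, Finset.sum_ite_eq', if_pos (Finset.mem_range.2 (by omega))]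
  rw [h1]
  exact ⟨ha _, inf_coeff ha (by omega)⟩

theorem tr_M {n : ℕ} {h : S q L → L} (hh : h ∈ M q K L (n+1) * M q K L (n+1)) :
    tr q K L n h ∈ M q K L n * M q K L n := by
  have hq := q_ge q
  refine Submodule.mul_induction_on hh (fun f hf g hg => ?_)
    (fun f g hf hg => by rw [map_add]; exact add_mem hf hg)
  · skip
    obtain ⟨a, ha, rfl⟩ := exists_coeff_M hf
    obtain ⟨b, hb, rfl⟩ := exists_coeff_M hg
    have h1 : tr q K L n ((∑ k ∈ Finset.range q, a k * u q L (n+1) ^ k) * (∑ l ∈ Finset.range q, b l * u q L (n+1) ^ l))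
        = ∑ k ∈ Finset.range q, ∑ l ∈ Finset.range q,
          if k + l = q - 1 ∨ k + l = 2 * q - 2 then a k * b l else 0 := by
      funext x
      rw [tr_apply]
      have h2 : ∀ β ∈ Fq q K, ((∑ k ∈ Finset.range q, a k * u q L (n+1) ^ k) *
          (∑ l ∈ Finset.range q, b l * u q L (n+1) ^ l)) (mv n x β)
          = ∑ k ∈ Finset.range q, ∑ l ∈ Finset.range q, a k x * b l x *
            (u q L (n+1) x + algebraMap K L β) ^ (k + l) := by
        intro β hβ
        rw [Pi.mul_apply, usum_apply, usum_apply, u_mv n x hβ, Finset.sum_mul_sum]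
        refine Finset.sum_congr rfl fun k _ => Finset.sum_congr rfl fun l _ => ?_
        rw [A_mv (ha k).1, A_mv (hb l).1, pow_add]; ring
      rw [Finset.sum_congr rfl h2, Finset.sum_comm, Finset.sum_apply]
      refine Finset.sum_congr rfl fun k hk => ?_
      rw [Finset.sum_comm, Finset.sum_apply]
      refine Finset.sum_congr rfl fun l hl => ?_
      rw [Finset.mem_range] at hk hl
      rw [← Finset.mul_sum, sum_pow_large _ (by omega)]
      split_ifs <;> simp
    rw [h1]
    refine sum_mem fun k _ => sum_mem fun l _ => ?_
    split_ifs
    · exact Submodule.mul_mem_mul (ha k) (hb l)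
    · exact zero_mem _

theorem MM_A {n : ℕ} {h : S q L → L} (hh : h ∈ M q K L n * M q K L n) : h ∈ A q K L n := by
  exact Submodule.mul_induction_on hh (fun f hf g hg => mul_mem hf.1 hg.1) (fun f g hf hg => add_mem hf hg)

theorem MM0 {h : S q L → L} (hh : h ∈ M q K L 0 * M q K L 0) : ∃ p : Polynomial K, h = pf q L p := by
  refine Submodule.mul_induction_on hh (fun f hf g hg => ?_) (fun f g hf hg => ?_)
  rotate_left
  · obtain ⟨p, rfl⟩ := hf
    obtain ⟨p', rfl⟩ := hg
    exact ⟨p + p', by funext x; simp [pf]⟩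
  · obtain ⟨p, rfl⟩ := M0_form hf
    obtain ⟨p', rfl⟩ := M0_form hg
    exact ⟨p * p', by funext x; simp [pf]⟩

end Tr
end GSC



namespace GSC
set_option linter.unusedSectionVars false
set_option linter.unusedSimpArgs false

section Pts
variable {q : ℕ} [hQ : QP q] {K L : Type} [Field K] [Fintype K] [CharP K 2] [hGS : GS q K]
  [NormedField L] [IsUltrametricDist L] [IsAlgClosed L] [CharP L 2] [Algebra K L] [hNT : NT L]

open Classical in
variable (q K) in
/-- Base points. -/
noncomputable def Bs : Finset K := Finset.univ \ Fq q K

theorem mem_Bs {α : K} : α ∈ Bs q K ↔ T q α ≠ 0 := by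
  simp [Bs, T_eq_zero_iff]

theorem card_Bs : (Bs q K).card = q ^ 2 - q := by
  classical
  rw [Bs, Finset.card_sdiff_of_subset (Finset.subset_univ _), card_Fq, Finset.card_univ, hGS.card]

variable (q K) in
/-- Rational points of level `n`. -/
def Pt : ℕ → Type
  | 0 => {α : K // α ∈ Bs q K}
  | n + 1 => Pt n × {β : K // β ∈ Fq q K}

variable (q K) in
/-- Finiteness. -/
@[reducible] noncomputable def PtFin : (n : ℕ) → Fintype (Pt q K n)
  | 0 => inferInstanceAs (Fintype {α : K // α ∈ Bs q K})
  | n + 1 => @instFintypeProd (Pt q K n) {β : K // β ∈ Fq q K} (PtFin n) inferInstance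

noncomputable instance (n : ℕ) : Fintype (Pt q K n) := PtFin q K n

theorem card_Pt (n : ℕ) : Fintype.card (Pt q K n) = (q ^ 2 - q) * q ^ n := by
  induction n with
  | zero =>
    have : Fintype.card (Pt q K 0) = Fintype.card {α : K // α ∈ Bs q K} := rfl
    rw [this, Fintype.card_coe, card_Bs, pow_zero, mul_one]
  | succ n ih =>
    have : Fintype.card (Pt q K (n+1)) = Fintype.card (Pt q K n × {β : K // β ∈ Fq q K}) := rfl
    rw [this, Fintype.card_prod, ih, Fintype.card_coe, card_Fq, pow_succ q n, mul_assoc]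

theorem sum_Pt_succ {R : Type} [AddCommMonoid R] (n : ℕ) (g : Pt q K (n+1) → R) :
    ∑ P, g P = ∑ P : Pt q K n, ∑ β : {β : K // β ∈ Fq q K}, g (P, β) := by
  exact Fintype.sum_prod_type (fun P : Pt q K n × {β : K // β ∈ Fq q K} => g P)

/-- The first coordinate. -/
def base : (n : ℕ) → Pt q K n → K
  | 0, P => P.1
  | n + 1, P => base n P.1

theorem base_mem (n : ℕ) (P : Pt q K n) : base n P ∈ Bs q K := by
  induction n with
  | zero => exact P.2
  | succ n ih => exact ih P.1

theorem exists_ev0 (P : {α : K // α ∈ Bs q K}) : ∃ x : S q L, x.1 0 = algebraMap K L P.1 := by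
  apply S.exists_start
  rw [← algebraMap_T]
  simpa using mem_Bs.1 P.2

variable (L) in
/-- The point as an element of the solution space. -/
noncomputable def ev : (n : ℕ) → Pt q K n → S q L
  | 0, P => (exists_ev0 P).choose
  | n + 1, P => mv n (ev n P.1) P.2.1

theorem ev_zero (n : ℕ) (P : Pt q K n) : (ev L n P).1 0 = algebraMap K L (base n P) := by
  induction n with
  | zero => exact (exists_ev0 (L := L) P).choose_spec
  | succ n ih => exact (mv_le n _ _ (Nat.zero_le n)).trans (ih P.1)

theorem ev_inj (n : ℕ) {P Q : Pt q K n} (h : ∀ i ≤ n, (ev L n P).1 i = (ev L n Q).1 i) : P = Q := by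
  induction n with
  | zero =>
    have h0 := h 0 le_rfl
    rw [ev_zero, ev_zero] at h0
    exact Subtype.ext ((algebraMap K L).injective h0)
  | succ n ih =>
    obtain ⟨P, β⟩ := P
    obtain ⟨Q, γ⟩ := Q
    change ∀ i ≤ n + 1, (mv n (ev L n P) β.1).1 i = (mv n (ev L n Q) γ.1).1 i at h
    have h1 : P = Q := by
      apply ih
      intro i hi
      have := h i (by omega)
      rwa [mv_le n _ _ hi, mv_le n _ _ hi] at this
    subst h1
    have h2 := h (n+1) le_rfl
    rw [mv_succ n _ β.2, mv_succ n _ γ.2] at h2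
    have h3 : β = γ := Subtype.ext ((algebraMap K L).injective (add_left_cancel h2))
    rw [h3]

theorem coord_K (x : S q L) (h0 : ∃ k : K, x.1 0 = algebraMap K L k) (i : ℕ) :
    ∃ k : K, x.1 i = algebraMap K L k := by
  induction i with
  | zero => exact h0
  | succ i ih =>
    obtain ⟨a, ha⟩ := ih
    have h1 := x.T_succ i
    rw [ha, ← algebraMap_T, ← map_inv₀, ← map_pow, ← map_mul] at h1
    have hb : a ^ (q+1) * (T q a)⁻¹ ∈ Fq q K := by
      rw [mem_Fq, mul_pow, inv_pow, mem_Fq.1 (T_mem_Fq a), ← pow_mul]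
      congr 1
      have : (q+1) * q = q^2 + q := by ring
      rw [this, pow_add, pow_qq, pow_succ']
    obtain ⟨b, hb⟩ := exists_T_eq hb
    rw [← hb, algebraMap_T] at h1
    obtain ⟨β, -, h2⟩ := eq_add_of_T_eq (K := K) h1
    exact ⟨b + β, by rw [h2, map_add]⟩

theorem val_K {n : ℕ} {f : S q L → L} (hf : f ∈ A q K L n) (x : S q L) (h0 : ∃ k : K, x.1 0 = algebraMap K L k) :
    ∃ k : K, algebraMap K L k = f x := by
  induction hf using Algebra.adjoin_induction with
  | mem f hf =>
    rcases hf with rfl | ⟨i, hi, rfl⟩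
    · obtain ⟨k, hk⟩ := h0
      exact ⟨(T q k)⁻¹, by rw [map_inv₀, algebraMap_T, ← hk]; rfl⟩
    · obtain ⟨k, hk⟩ := coord_K x h0 i
      exact ⟨k, hk.symm⟩
  | algebraMap r => exact ⟨r, rfl⟩
  | add f g _ _ hf hg =>
    obtain ⟨a, ha⟩ := hf
    obtain ⟨b, hb⟩ := hg
    exact ⟨a + b, by rw [map_add, ha, hb]; rfl⟩
  | mul f g _ _ hf hg =>
    obtain ⟨a, ha⟩ := hf
    obtain ⟨b, hb⟩ := hg
    exact ⟨a * b, by rw [map_mul, ha, hb]; rfl⟩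

/-- The value in `K`. -/
noncomputable def kv (n : ℕ) (f : S q L → L) (P : Pt q K n) : K :=
  Function.invFun (algebraMap K L) (f (ev L n P))

theorem kv_eq {n : ℕ} {f : S q L → L} (hf : f ∈ A q K L n) (P : Pt q K n) :
    algebraMap K L (kv n f P) = f (ev L n P) :=
  Function.invFun_eq (val_K hf _ ⟨_, ev_zero n P⟩)

theorem indicator {n : ℕ} (P : Pt q K n) : ∃ f ∈ A q K L n, ∀ Q : Pt q K n, (Q = P → f (ev L n Q) = 1) ∧
    (Q ≠ P → f (ev L n Q) = 0) := by
  have hc := fun (Q : Pt q K n) i => coord_K (ev L n Q) ⟨_, ev_zero n Q⟩ i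
  choose c hc using hc
  have hq1 : q ^ 2 - 1 ≠ 0 := by
    have := q_ge q
    have : 4 * 4 ≤ q * q := Nat.mul_le_mul this this
    rw [sq]; omega
  refine ⟨∏ i ∈ Finset.range (n+1), (1 - (X q L i - algebraMap K (S q L → L) (c P i)) ^ (q^2-1)), ?_, fun Q => ⟨?_, ?_⟩⟩
  · refine prod_mem fun i hi => sub_mem (one_mem _) (pow_mem (sub_mem (X_mem ?_) (algebraMap_mem _ _)) _)
    have := Finset.mem_range.1 hi; omega
  · rintro rfl
    rw [Finset.prod_apply]
    apply Finset.prod_eq_one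
    intro i _
    change 1 - ((ev L n Q).1 i - algebraMap K L (c Q i)) ^ (q^2-1) = 1
    rw [hc, sub_self, zero_pow hq1, sub_zero]
  · intro hne
    have : ∃ i ≤ n, (ev L n Q).1 i ≠ (ev L n P).1 i := by
      by_contra hcon
      push Not at hcon
      exact hne (ev_inj n hcon)
    obtain ⟨i, hi, hne⟩ := this
    rw [Finset.prod_apply]
    apply Finset.prod_eq_zero (Finset.mem_range.2 (Nat.lt_succ_of_le hi))
    change 1 - ((ev L n Q).1 i - algebraMap K L (c P i)) ^ (q^2-1) = 0
    rw [hc, hc] at hne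
    rw [hc, ← map_sub, ← map_pow, ← hGS.card, FiniteField.pow_card_sub_one_eq_one, map_one, sub_self]
    intro h0
    rw [sub_eq_zero] at h0
    exact hne (by rw [h0])

open Classical in
variable (q) in
/-- Residues of the base differential. -/
noncomputable def vw (α : K) : K := (∏ γ ∈ (Bs q K).erase α, (α - γ))⁻¹

theorem vw_ne (α : K) : vw q α ≠ 0 := by
  classical
  rw [vw]
  apply inv_ne_zero
  rw [Finset.prod_ne_zero_iff]
  intro γ hγ h
  exact (Finset.mem_erase.1 hγ).1 (sub_eq_zero.1 h).symm

variable (q) in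
theorem exists_sqrt (v : K) : ∃ w : K, w * w = v ∧ 0 < q := by
  refine ⟨v ^ (q ^ 2 / 2), ?_, q_pos q⟩
  rw [← pow_add]
  have : q ^ 2 / 2 + q ^ 2 / 2 = q ^ 2 := by
    obtain ⟨m, hm, rfl⟩ := hQ.pow
    rw [← two_mul]
    apply Nat.mul_div_cancel'
    exact dvd_pow (dvd_pow_self 2 (by omega)) (by omega)
  rw [this, pow_qq]

variable (q) in
/-- Square roots of the residues. -/
noncomputable def ww (α : K) : K := (exists_sqrt q (vw q α)).choose

theorem ww_sq (α : K) : ww q α * ww q α = vw q α := (exists_sqrt q (vw q α)).choose_spec.1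

theorem ww_ne (α : K) : ww q α ≠ 0 := by
  intro h
  have := ww_sq (q := q) α
  rw [h, zero_mul] at this
  exact vw_ne α this.symm

theorem residue (n : ℕ) {h : S q L → L} (hh : h ∈ M q K L n * M q K L n)
    (hs : ‖h (xinf q L)‖ < Γ q L n ^ ((q ^ 2 - q) * q ^ n - 1)) :
    ∑ P : Pt q K n, algebraMap K L (vw q (base n P)) * h (ev L n P) = 0 := by
  classical
  have hq := q_ge q
  have hqq : 2 ≤ q ^ 2 - q := by
    have : 4 * q ≤ q * q := Nat.mul_le_mul_right q hq
    rw [sq]; omega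
  induction n generalizing h with
  | zero =>
    obtain ⟨p, rfl⟩ := MM0 hh
    have h1 : ∑ P : Pt q K 0, algebraMap K L (vw q (base 0 P)) * pf q L p (ev L 0 P)
        = ∑ P : {α : K // α ∈ Bs q K}, algebraMap K L (p.eval P.1 / ∏ γ ∈ (Bs q K).erase P.1, (P.1 - γ)) := by
      have h0 : ∀ P : Pt q K 0, algebraMap K L (vw q (base 0 P)) * pf q L p (ev L 0 P)
          = algebraMap K L (p.eval (base 0 P) / ∏ γ ∈ (Bs q K).erase (base 0 P), (base 0 P - γ)) := by
        intro P
        rw [pf, ev_zero, Polynomial.aeval_algebraMap_apply, div_eq_mul_inv, mul_comm, Polynomial.coe_aeval_eq_eval,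
          map_mul]
        simp only [vw]
      rw [Finset.sum_congr rfl fun P _ => h0 P]
      rfl
    rw [h1, Finset.sum_coe_sort (Bs q K) (fun α => algebraMap K L (p.eval α / ∏ γ ∈ (Bs q K).erase α, (α - γ))),
      ← map_sum]
    have hd : p.natDegree < q ^ 2 - q - 1 := by
      by_cases hp : p = 0
      · rw [hp, Polynomial.natDegree_zero]; omega
      obtain ⟨w, hw, h2⟩ := pf_lead (q := q) (L := L) p hp
      rw [h2, norm_mul, norm_mul, norm_K (Polynomial.leadingCoeff_ne_zero.2 hp), hw.norm, one_mul, mul_one, norm_pow,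
        pow_zero, mul_one] at hs
      exact (pow_lt_pow_iff_right₀ (one_lt_Γ (q := q) (L := L) 0)).1 hs
    have hdeg : p.degree < (Bs q K).card := by
      rw [card_Bs]
      refine Polynomial.degree_le_natDegree.trans_lt ?_
      exact_mod_cast (by omega : p.natDegree < q ^ 2 - q)
    have h3 := Lagrange.coeff_eq_sum (s := Bs q K) (v := id) (Set.injOn_id _) (P := p) hdeg
    simp only [id] at h3
    rw [← h3, card_Bs, Polynomial.coeff_eq_zero_of_natDegree_lt hd, map_zero]
  | succ n ih =>
    rw [sum_Pt_succ]
    obtain ⟨-, h2⟩ := tr_inf (MM_A hh)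
    have h3 := ih (tr_M hh) (by
      have hpos : 0 < Γ q L (n+1) ^ (q-1) := pow_pos (Γ_pos _) _
      rw [← mul_lt_mul_iff_left₀ hpos]
      refine h2.trans_lt (hs.trans_eq ?_)
      rw [← Γ_pow n, ← pow_mul, ← pow_add]
      congr 1
      have : 1 ≤ (q ^ 2 - q) * q ^ n := Nat.mul_pos (by omega) (pow_pos (by omega) n)
      obtain ⟨t, ht⟩ := Nat.exists_eq_add_of_le this
      rw [pow_succ q n, ← mul_assoc, ht, Nat.add_sub_cancel_left, add_mul, mul_comm t]
      omega)
    rw [← h3]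
    refine Finset.sum_congr rfl fun P _ => ?_
    rw [tr_apply, Finset.mul_sum, ← Finset.sum_coe_sort (Fq q K)]
    rfl

end Pts
end GSC



namespace GSC
set_option linter.unusedSectionVars false
set_option linter.unusedSimpArgs false

section Code
variable {q : ℕ} [hQ : QP q] {K L : Type} [Field K] [Fintype K] [CharP K 2] [hGS : GS q K]
  [NormedField L] [IsUltrametricDist L] [IsAlgClosed L] [CharP L 2] [Algebra K L] [hNT : NT L]
variable {ι : Type} [Fintype ι]

/-- The syndrome functional of a word. -/
noncomputable def Sf {n : ℕ} (e : ι ≃ Pt q K n) (y : ι → K) : (S q L → L) →ₗ[K] L :=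
  ∑ i, (y i * ww q (base n (e i))) • (LinearMap.proj (ev L n (e i)) : (S q L → L) →ₗ[K] L)

theorem Sf_apply {n : ℕ} (e : ι ≃ Pt q K n) (y : ι → K) (f : S q L → L) :
    Sf e y f = ∑ i, algebraMap K L (y i * ww q (base n (e i))) * f (ev L n (e i)) := by
  simp [Sf, LinearMap.sum_apply, Algebra.smul_def]

theorem Sf_ne {n : ℕ} (e : ι ≃ Pt q K n) (y : ι → K) (hy : y ≠ 0) :
    ∃ f ∈ M q K L n, Sf e y f ≠ 0 := by
  classical
  obtain ⟨j, hj⟩ := Function.ne_iff.1 hy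
  obtain ⟨g, hg, hg2⟩ := indicator (q := q) (K := K) (L := L) (e j)
  obtain ⟨k, hk⟩ := exists_pow_M hg
  refine ⟨_, hk, ?_⟩
  rw [Sf_apply, Finset.sum_eq_single j]
  · have h0 : T0 q L (ev L n (e j)) ≠ 0 := by
      have := (ev L n (e j)).norm_T_pos 0
      exact norm_pos_iff.1 this
    simp only [Pi.mul_apply, Pi.pow_apply, (hg2 (e j)).1 rfl, mul_one]
    refine mul_ne_zero ?_ (pow_ne_zero _ h0)
    simpa using ⟨hj, ww_ne _⟩
  · intro i _ hi
    simp [(hg2 (e i)).2 (by simpa using hi)]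
  · simp

theorem Sf_min {n : ℕ} (e : ι ≃ Pt q K n) (y : ι → K) (hy : y ≠ 0) :
    ∃ s, Sf e y (F q K L n s) ≠ 0 ∧ (∀ t < s, Sf e y (F q K L n t) = 0) := by
  classical
  have hex : ∃ s, Sf e y (F q K L n s) ≠ 0 := by
    by_contra! hcon
    obtain ⟨f, hf, hf2⟩ := Sf_ne (L := L) e y hy
    apply hf2
    obtain ⟨s, hs⟩ := pow_unbounded_of_one_lt ‖f (xinf q L)‖ (one_lt_Γ (q := q) (L := L) n)
    have h1 := M_span s hf hs
    have h2 : Submodule.span K (F q K L n '' Set.Iio s) ≤ LinearMap.ker (Sf e y) := by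
      rw [Submodule.span_le]
      rintro _ ⟨t, -, rfl⟩
      exact hcon t
    exact h2 h1
  exact ⟨Nat.find hex, Nat.find_spec hex, fun t ht => by simpa using Nat.find_min hex ht⟩

theorem Sf_lead {n : ℕ} (e : ι ≃ Pt q K n) (y : ι → K) {s : ℕ} (hs : Sf e y (F q K L n s) ≠ 0)
    (hm : ∀ t < s, Sf e y (F q K L n t) = 0) {f : S q L → L} (hf : f ∈ M q K L n)
    (hn : ‖f (xinf q L)‖ = Γ q L n ^ s) : Sf e y f ≠ 0 := by
  have hf0 : f ≠ 0 := by
    rintro rfl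
    simp only [Pi.zero_apply, norm_zero] at hn
    exact (pow_pos (Γ_pos (q := q) (L := L) n) s).ne hn
  obtain ⟨s', c, g, hc, hg, h1, h2, h3⟩ := M_lead hf hf0
  have : s' = s := (pow_right_injective₀ (Γ_pos (q := q) (L := L) n) (one_lt_Γ n).ne') (h2.symm.trans hn)
  subst this
  have h4 : Submodule.span K (F q K L n '' Set.Iio s') ≤ LinearMap.ker (Sf e y) := by
    rw [Submodule.span_le]
    rintro _ ⟨t, ht, rfl⟩
    exact hm t ht
  have h5 : Sf e y g = 0 := h4 (M_span s' hg h3)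
  rw [h1, map_add, map_smul, h5, add_zero]
  exact smul_ne_zero hc hs

theorem comb_norm {n : ℕ} (m : ℕ) (c : ℕ → K) (hc : ∃ b < m, c b ≠ 0) :
    ∃ B < m, ‖(∑ b ∈ Finset.range m, c b • F q K L n b) (xinf q L)‖ = Γ q L n ^ B := by
  classical
  induction m with
  | zero => obtain ⟨b, hb, -⟩ := hc; omega
  | succ m ih =>
    rw [Finset.sum_range_succ]
    by_cases h : c m = 0
    · rw [h, zero_smul, add_zero]
      obtain ⟨B, hB, h2⟩ := ih (by
        obtain ⟨b, hb, hb2⟩ := hc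
        refine ⟨b, lt_of_le_of_ne (by omega) ?_, hb2⟩
        rintro rfl; exact hb2 h)
      exact ⟨B, by omega, h2⟩
    · refine ⟨m, by omega, ?_⟩
      have h1 : ‖(∑ b ∈ Finset.range m, c b • F q K L n b) (xinf q L)‖ < Γ q L n ^ m := by
        rw [Finset.sum_apply]
        refine norm_sum_lt_of _ _ (pow_pos (Γ_pos _) _) fun b hb => ?_
        rw [Pi.smul_apply, Algebra.smul_def, norm_mul, F_norm]
        calc _ ≤ 1 * Γ q L n ^ b := mul_le_mul_of_nonneg_right (norm_K_le _) (pow_pos (Γ_pos _) _).le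
          _ < _ := by
            rw [one_mul]
            exact pow_lt_pow_right₀ (one_lt_Γ n) (Finset.mem_range.1 hb)
      have h2 : ‖(c m • F q K L n m) (xinf q L)‖ = Γ q L n ^ m := by
        rw [Pi.smul_apply, Algebra.smul_def, norm_mul, F_norm, norm_K h, one_mul]
      rw [Pi.add_apply, norm_add_right, h2]
      rw [h2]; exact h1

theorem exists_vanish {n : ℕ} (e : ι ≃ Pt q K n) (y : ι → K) (m : ℕ) (h : hWeight y < m) :
    ∃ c : ℕ → K, (∃ b < m, c b ≠ 0) ∧ ∀ i, y i ≠ 0 →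
      (∑ b ∈ Finset.range m, c b • F q K L n b) (ev L n (e i)) = 0 := by
  classical
  let φ : (Fin m → K) →ₗ[K] ({i // y i ≠ 0} → K) :=
    LinearMap.pi fun i => ∑ b : Fin m, (kv n (F q K L n b) (e i)) • LinearMap.proj b
  have hlt : Module.finrank K ({i // y i ≠ 0} → K) < Module.finrank K (Fin m → K) := by
    rw [Module.finrank_fintype_fun_eq_card, Module.finrank_fintype_fun_eq_card, Fintype.card_fin]
    rw [hWeight, ← Nat.card_coe_set_eq, Nat.card_eq_fintype_card] at h
    convert h
  obtain ⟨c, hc, hc0⟩ := (Submodule.ne_bot_iff _).1 (LinearMap.ker_ne_bot_of_finrank_lt (f := φ) hlt)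
  refine ⟨fun b => if hb : b < m then c ⟨b, hb⟩ else 0, ?_, fun i hi => ?_⟩
  · obtain ⟨b, hb⟩ := Function.ne_iff.1 hc0
    exact ⟨b, b.2, by simpa using hb⟩
  · have h1 : φ c ⟨i, hi⟩ = 0 := by rw [LinearMap.mem_ker.1 hc]; rfl
    have h2 := congrArg (algebraMap K L) h1
    simp only [φ, LinearMap.pi_apply, LinearMap.sum_apply, LinearMap.smul_apply, LinearMap.proj_apply, smul_eq_mul,
      map_sum, map_mul, map_zero] at h2
    rw [Finset.sum_apply, ← Fin.sum_univ_eq_sum_range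
      (fun b => ((if hb : b < m then c ⟨b, hb⟩ else 0) • F q K L n b) (ev L n (e i)))]
    rw [← h2]
    refine Finset.sum_congr rfl fun b _ => ?_
    rw [kv_eq (F_mem n b).1]
    simp [Algebra.smul_def, mul_comm]

theorem Sf_dist {n : ℕ} (e : ι ≃ Pt q K n) (y : ι → K) {s : ℕ} (hs : Sf e y (F q K L n s) ≠ 0)
    (hm : ∀ t < s, Sf e y (F q K L n t) = 0) : s + 1 ≤ hWeight y + q * q ^ n := by
  by_contra! hcon
  obtain ⟨s', rfl⟩ := Nat.exists_eq_add_of_le (by omega : q * q ^ n ≤ s)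
  obtain ⟨c, hc, hv⟩ := exists_vanish (L := L) e y (s' + 1) (by omega)
  obtain ⟨B, hB, hn⟩ := comb_norm (q := q) (L := L) (n := n) (s' + 1) c hc
  set f := ∑ b ∈ Finset.range (s' + 1), c b • F q K L n b with hf
  have hfM : f ∈ M q K L n := Submodule.sum_mem _ fun b _ => Submodule.smul_mem _ _ (F_mem n b)
  refine Sf_lead e y hs hm (T0_mul_M hfM (F_mem n (s' - B))) ?_ ?_
  · rw [Pi.mul_apply, Pi.mul_apply, norm_mul, norm_mul, T0_norm n, hn, F_norm, ← pow_add, ← pow_add]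
    congr 1; omega
  · rw [Sf_apply]
    refine Finset.sum_eq_zero fun i _ => ?_
    by_cases hi : y i = 0
    · simp [hi]
    · simp [hv i hi]

variable (L) in
/-- The check functionals. -/
noncomputable def chk {n : ℕ} (e : ι ≃ Pt q K n) (a : ℕ) : (ι → K) →ₗ[K] K :=
  ∑ i, (ww q (base n (e i)) * kv n (F q K L n a) (e i)) • LinearMap.proj i

theorem chk_apply {n : ℕ} (e : ι ≃ Pt q K n) (a : ℕ) (y : ι → K) :
    chk L e a y = ∑ i, (ww q (base n (e i)) * kv n (F q K L n a) (e i)) * y i := by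
  simp [chk, LinearMap.sum_apply]

theorem chk_Sf {n : ℕ} (e : ι ≃ Pt q K n) (a : ℕ) (y : ι → K) :
    algebraMap K L (chk L e a y) = Sf e y (F q K L n a) := by
  rw [chk_apply, Sf_apply, map_sum]
  refine Finset.sum_congr rfl fun i _ => ?_
  rw [map_mul, map_mul, map_mul, kv_eq (F_mem n a).1]; ring

end Code

theorem code (q : ℕ) [hQ : QP q] (K L : Type) [Field K] [Fintype K] [CharP K 2] [hGS : GS q K]
    [NormedField L] [IsUltrametricDist L] [IsAlgClosed L] [CharP L 2] [Algebra K L] [hNT : NT L] (n k : ℕ) (hk : 2 * k ≤ (q ^ 2 - q) * q ^ n) :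
    ∃ D : Submodule K (Fin ((q ^ 2 - q) * q ^ n) → K),
      eucDual (D : Set (Fin ((q ^ 2 - q) * q ^ n) → K)) ⊆ D ∧
      (q ^ 2 - q) * q ^ n ≤ Module.finrank K D + k ∧
      ∀ y ∈ D, y ≠ 0 → k + 1 ≤ hWeight y + q * q ^ n := by
  classical
  let e : Fin ((q ^ 2 - q) * q ^ n) ≃ Pt q K n := (Fintype.equivFinOfCardEq (card_Pt n)).symm
  let φ : (Fin ((q ^ 2 - q) * q ^ n) → K) →ₗ[K] (Fin k → K) := LinearMap.pi fun a => chk L e a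
  have hmem : ∀ y, y ∈ LinearMap.ker φ ↔ ∀ a : Fin k, chk L e a y = 0 := by
    intro y
    rw [LinearMap.mem_ker, funext_iff]; rfl
  refine ⟨LinearMap.ker φ, ?_, ?_, ?_⟩
  · intro x hx
    -- the functional of x
    let ψ : (Fin ((q ^ 2 - q) * q ^ n) → K) →ₗ[K] K := ∑ i, x i • LinearMap.proj i
    have hψ : ∀ y, ψ y = ∑ i, x i * y i := by
      intro y; simp [ψ, LinearMap.sum_apply]
    have h1 : (⨅ a : Fin k, LinearMap.ker (chk L e a)) ≤ LinearMap.ker ψ := by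
      intro y hy
      rw [LinearMap.mem_ker, hψ]
      apply hx
      rw [SetLike.mem_coe, hmem]
      intro a
      exact (Submodule.mem_iInf _).1 hy a
    have h2 := mem_span_of_iInf_ker_le_ker h1
    obtain ⟨c, hc⟩ := (Submodule.mem_span_range_iff_exists_fun K).1 h2
    have hx2 : ∀ i, x i = ∑ a : Fin k, c a * (ww q (base n (e i)) * kv n (F q K L n a) (e i)) := by
      intro i
      have h3 := congrArg (fun g => g (Pi.single i 1)) hc
      simp only [hψ, LinearMap.sum_apply, LinearMap.smul_apply, smul_eq_mul, chk_apply] at h3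
      simpa [Pi.single_apply] using h3.symm
    rw [SetLike.mem_coe, hmem]
    intro b
    have key : ∀ a : Fin k, ∑ i, (ww q (base n (e i)) * kv n (F q K L n b) (e i)) *
        (ww q (base n (e i)) * kv n (F q K L n a) (e i)) = 0 := by
      intro a
      apply (algebraMap K L).injective
      rw [map_zero, map_sum]
      have h4 := residue (q := q) (K := K) (L := L) n (h := F q K L n b * F q K L n a)
        (Submodule.mul_mem_mul (F_mem n b) (F_mem n a)) (by
          rw [Pi.mul_apply, norm_mul, F_norm, F_norm, ← pow_add]
          apply pow_lt_pow_right₀ (one_lt_Γ n)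
          have := a.2
          have := b.2
          omega)
      rw [← h4, ← Equiv.sum_comp e]
      refine Finset.sum_congr rfl fun i _ => ?_
      rw [← ww_sq, Pi.mul_apply, ← kv_eq (F_mem n b).1, ← kv_eq (F_mem n a).1]
      simp only [map_mul]; ring
    rw [chk_apply]
    simp only [hx2, Finset.mul_sum]
    rw [Finset.sum_comm]
    refine Finset.sum_eq_zero fun a _ => ?_
    have h5 := key a
    calc _ = c a * ∑ i, (ww q (base n (e i)) * kv n (F q K L n b) (e i)) *
        (ww q (base n (e i)) * kv n (F q K L n a) (e i)) := by
          rw [Finset.mul_sum]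
          exact Finset.sum_congr rfl fun i _ => by ring
      _ = 0 := by rw [h5, mul_zero]
  · have h1 := LinearMap.finrank_range_add_finrank_ker φ
    have h2 : Module.finrank K (LinearMap.range φ) ≤ k := by
      refine (Submodule.finrank_le _).trans ?_
      simp
    rw [Module.finrank_fintype_fun_eq_card, Fintype.card_fin] at h1
    omega
  · intro y hy hy0
    obtain ⟨s, hs, hm⟩ := Sf_min (L := L) e y hy0
    have h1 := Sf_dist e y hs hm
    have h2 : k ≤ s := by
      by_contra! hcon
      apply hs
      rw [← chk_Sf, (hmem y).1 hy ⟨s, hcon⟩, map_zero]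
    omega

end GSC



namespace GSC
set_option linter.unusedSectionVars false
set_option linter.unusedSimpArgs false

open scoped WithZero in
theorem exists_L (K : Type) [Field K] [CharP K 2] :
    ∃ (L : Type) (_ : NormedField L) (_ : Algebra K L), IsUltrametricDist L ∧ IsAlgClosed L ∧ CharP L 2 ∧ NT L := by
  have hnt : (Valued.v : Valuation (LaurentSeries K) ℤᵐ⁰).IsNontrivial := by
    refine ⟨⟨HahnSeries.single 1 1, ?_, ?_⟩⟩
    · rw [Valuation.ne_zero_iff]; simp
    · have := LaurentSeries.valuation_single_zpow K 1
      rw [this]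
      decide +revert
  have hne : Nonempty ((Valued.v : Valuation (LaurentSeries K) ℤᵐ⁰).RankOne) := by
    rw [Valuation.nonempty_rankOne_iff_mulArchimedean]
    infer_instance
  let hr := hne.some
  let : NontriviallyNormedField (LaurentSeries K) :=
    Valued.toNontriviallyNormedField (LaurentSeries K) ℤᵐ⁰
  have : IsUltrametricDist (LaurentSeries K) :=
    IsUltrametricDist.isUltrametricDist_of_isNonarchimedean_norm (Valued.isNonarchimedean_norm (LaurentSeries K) ℤᵐ⁰)
  have : CompleteSpace (LaurentSeries K) := LaurentSeries.instLaurentSeriesComplete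
  let hL : NormedField (AlgebraicClosure (LaurentSeries K)) :=
    spectralNorm.normedField (LaurentSeries K) (AlgebraicClosure (LaurentSeries K))
  refine ⟨AlgebraicClosure (LaurentSeries K), hL,
    ((algebraMap (LaurentSeries K) (AlgebraicClosure (LaurentSeries K))).comp (HahnSeries.C)).toAlgebra, ?_, ?_, ?_, ?_⟩
  · exact IsUltrametricDist.isUltrametricDist_of_isNonarchimedean_norm
      (isNonarchimedean_spectralNorm (K := LaurentSeries K))
  · exact AlgebraicClosure.isAlgClosed _
  · exact charP_of_injective_ringHom (((algebraMap (LaurentSeries K) (AlgebraicClosure (LaurentSeries K))).comp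
      (HahnSeries.C)).injective) 2
  · obtain ⟨x, hx0, hx⟩ := NormedField.exists_norm_lt_one (LaurentSeries K)
    refine ⟨algebraMap _ _ x, ?_, ?_⟩
    · simpa using norm_pos_iff.1 hx0
    · exact (spectralNorm_extends x).trans_lt hx

theorem codeK (m : ℕ) (hm : 2 ≤ m) (n k : ℕ) (hk : 2 * k ≤ ((2^m) ^ 2 - 2^m) * (2^m) ^ n) :
    ∃ D : Submodule (GaloisField 2 (2 * m)) (Fin (((2^m) ^ 2 - 2^m) * (2^m) ^ n) → GaloisField 2 (2 * m)),
      eucDual (D : Set (Fin (((2^m) ^ 2 - 2^m) * (2^m) ^ n) → GaloisField 2 (2 * m))) ⊆ D ∧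
      ((2^m) ^ 2 - 2^m) * (2^m) ^ n ≤ Module.finrank (GaloisField 2 (2 * m)) D + k ∧
      ∀ y ∈ D, y ≠ 0 → k + 1 ≤ hWeight y + 2^m * (2^m) ^ n := by
  let : Fintype (GaloisField 2 (2 * m)) := Fintype.ofFinite _
  have : QP (2^m) := ⟨⟨m, hm, rfl⟩⟩
  have : GS (2^m) (GaloisField 2 (2 * m)) := ⟨by
    rw [← Nat.card_eq_fintype_card, GaloisField.card 2 (2*m) (by omega), ← pow_mul, mul_comm]⟩
  obtain ⟨L, h1, h2, h3, h4, h5, h6⟩ := exists_L (GaloisField 2 (2 * m))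
  exact code (2^m) (GaloisField 2 (2 * m)) L n k hk

end GSC

/-- For `q = 2^m` (`m ≥ 2`) and `1/2 ≤ R' ≤ 1 − 1/(2^m − 1)` there is a
sequence of `F_{q^2}`-linear codes `D_i ⊆ F_{q^2}^{N_i}` containing their
Euclidean duals, with `N_i → ∞`, `liminf (dim D_i)/N_i ≥ R'` and
`liminf d_H(D_i)/N_i ≥ 1 − R' − 1/(2^m − 1)`. -/
theorem good_sequence_classical_selfdual (m : ℕ) (hm : 2 ≤ m)
    (R' : ℝ) (hR1 : 1 / 2 ≤ R') (hR2 : R' ≤ 1 - 1 / ((2 : ℝ) ^ m - 1)) :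
    ∃ (N : ℕ → ℕ)
      (D : (i : ℕ) → Submodule (GaloisField 2 (2 * m))
              (Fin (N i) → GaloisField 2 (2 * m))),
      (∀ i, eucDual ((D i : Set (Fin (N i) → GaloisField 2 (2 * m))))
              ⊆ (D i : Set (Fin (N i) → GaloisField 2 (2 * m)))) ∧
      Tendsto N atTop atTop ∧
      R' ≤ liminf (fun i =>
            (Module.finrank (GaloisField 2 (2 * m)) (D i) : ℝ) / (N i : ℝ)) atTop ∧
      1 - R' - 1 / ((2 : ℝ) ^ m - 1)
        ≤ liminf (fun i =>
            ((minHammingDist (D i : Set (Fin (N i) → GaloisField 2 (2 * m))) : ℝ))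
              / (N i : ℝ)) atTop := by
  classical
  have hq4 : 4 ≤ 2 ^ m := by
    calc 4 = 2 ^ 2 := rfl
      _ ≤ 2 ^ m := Nat.pow_le_pow_right (by norm_num) hm
  obtain ⟨q, hq⟩ : ∃ q, q = 2 ^ m := ⟨_, rfl⟩
  have hqR : ((2:ℝ) ^ m) = (q : ℝ) := by rw [hq]; push_cast; rfl
  rw [← hq] at hq4
  have hq4R : (4:ℝ) ≤ q := by exact_mod_cast hq4
  let N : ℕ → ℕ := fun i => (q ^ 2 - q) * q ^ i
  have hNR : ∀ i, (N i : ℝ) = (q * (q - 1)) * q ^ i := by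
    intro i
    have : q ≤ q ^ 2 := by nlinarith
    simp only [N]
    push_cast [Nat.cast_sub this]
    ring
  have hNpos : ∀ i, (0:ℝ) < N i := by
    intro i
    rw [hNR]
    have : (0:ℝ) < q - 1 := by linarith
    positivity
  let k : ℕ → ℕ := fun i => ⌊(1 - R') * N i⌋₊
  have hinv : (0:ℝ) ≤ 1 / ((q:ℝ) - 1) := by
    apply div_nonneg zero_le_one; linarith
  have hR0 : 0 ≤ 1 - R' := by rw [hqR] at hR2; linarith
  have hkR : ∀ i, (k i : ℝ) ≤ (1 - R') * N i := fun i => Nat.floor_le (mul_nonneg hR0 (hNpos i).le)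
  have hkR2 : ∀ i, (1 - R') * N i < k i + 1 := fun i => Nat.lt_floor_add_one _
  have hk2 : ∀ i, 2 * k i ≤ N i := by
    intro i
    have h1 := hkR i
    have h2 := hNpos i
    have : (2 * k i : ℝ) ≤ N i := by nlinarith
    exact_mod_cast this
  have hcode : ∀ i, ∃ D : Submodule (GaloisField 2 (2 * m)) (Fin (N i) → GaloisField 2 (2 * m)),
      eucDual (D : Set (Fin (N i) → GaloisField 2 (2 * m))) ⊆ D ∧
      N i ≤ Module.finrank (GaloisField 2 (2 * m)) D + k i ∧
      ∀ y ∈ D, y ≠ 0 → k i + 1 ≤ hWeight y + q * q ^ i := by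
    intro i
    have h := GSC.codeK m hm i (k i)
    rw [← hq] at h
    exact h (hk2 i)
  choose D hD1 hD2 hD3 using hcode
  have hdim : ∀ i, R' * N i ≤ Module.finrank (GaloisField 2 (2 * m)) (D i) := by
    intro i
    have h1 : (N i : ℝ) ≤ Module.finrank (GaloisField 2 (2 * m)) (D i) + k i := by exact_mod_cast hD2 i
    have h2 := hkR i
    linarith
  have hex : ∀ i, ∃ y ∈ D i, y ≠ 0 := by
    intro i
    apply Submodule.exists_mem_ne_zero_of_ne_bot
    intro h
    have h1 := hdim i
    rw [h, finrank_bot, Nat.cast_zero] at h1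
    have h2 := hNpos i
    nlinarith
  have hmin : ∀ i, ∃ y ∈ D i, y ≠ 0 ∧
      minHammingDist (D i : Set (Fin (N i) → GaloisField 2 (2 * m))) = hWeight y := by
    intro i
    obtain ⟨y, hy, hy0⟩ := hex i
    obtain ⟨z, ⟨hz, hz0⟩, h⟩ := Nat.sInf_mem (s := hWeight '' {x ∈ (D i : Set (Fin (N i) → GaloisField 2 (2 * m))) | x ≠ 0})
      ⟨_, y, ⟨hy, hy0⟩, rfl⟩
    exact ⟨z, hz, hz0, h.symm⟩
  have hdle : ∀ i, minHammingDist (D i : Set (Fin (N i) → GaloisField 2 (2 * m))) ≤ N i := by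
    intro i
    obtain ⟨y, -, -, h⟩ := hmin i
    rw [h, hWeight]
    refine (Set.ncard_le_card _).trans ?_
    simp
  have hdge : ∀ i, (1 - R' - 1 / ((q:ℝ) - 1)) * N i ≤
      minHammingDist (D i : Set (Fin (N i) → GaloisField 2 (2 * m))) := by
    intro i
    obtain ⟨y, hy, hy0, h⟩ := hmin i
    rw [h]
    have h1 : ((k i + 1 : ℕ) : ℝ) ≤ ((hWeight y + q * q ^ i : ℕ) : ℝ) := by exact_mod_cast hD3 i y hy hy0
    push_cast at h1
    have h2 := hkR2 i
    have h3 : 1 / ((q:ℝ) - 1) * N i = q * q ^ i := by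
      rw [hNR]
      have : (q:ℝ) - 1 ≠ 0 := by linarith
      field_simp
    rw [sub_mul, h3]
    linarith
  have hfin : ∀ i, Module.finrank (GaloisField 2 (2 * m)) (D i) ≤ N i := by
    intro i
    refine (Submodule.finrank_le _).trans ?_
    simp
  refine ⟨N, D, hD1, ?_, ?_, ?_⟩
  · refine tendsto_atTop_mono (fun i => ?_) tendsto_id
    have h1 : i < q ^ i := Nat.lt_pow_self (by omega)
    have h2 : 1 ≤ q ^ 2 - q := by
      have : q + 1 ≤ q ^ 2 := by nlinarith
      omega
    simp only [N, id]
    nlinarith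
  · refine le_liminf_of_le ?_ (Eventually.of_forall fun i => ?_)
    · refine IsBoundedUnder.isCoboundedUnder_ge (isBoundedUnder_of ⟨1, fun i => ?_⟩)
      exact (div_le_one (hNpos i)).2 (by exact_mod_cast hfin i)
    · exact (le_div_iff₀ (hNpos i)).2 (hdim i)
  · rw [hqR]
    refine le_liminf_of_le ?_ (Eventually.of_forall fun i => ?_)
    · refine IsBoundedUnder.isCoboundedUnder_ge (isBoundedUnder_of ⟨1, fun i => ?_⟩)
      exact (div_le_one (hNpos i)).2 (by exact_mod_cast hdle i)
    · exact (le_div_iff₀ (hNpos i)).2 (hdge i)
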